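/- The map φ ↦ (P_SWᴼ(φ), Q_SWᴼ(φ)) is a bijection from the set of primed compatible sequences to the set of pairs (P, Q) of semistandard shifted tableaux of the same shape in which P has no primed entries on the main diagonal. Moreover, if A = [A_{ij}] is the circled matrix of φ, then for each j the sum Σ_i A_{ij} equals the number of entries of P_SWᴼ(φ) equal to j or j', and the sum Σ_k A_{jk} equals the number of entries of Q_SWᴼ(φ) equal to j or j'. -/

import Mathlib

/-! ## Primed letters: the alphabet `ℤ ⊔ ℤ'`, with `i' = i - 1/2`.
A letter is encoded by its "ceiling" together with a flag recording whether it is primed. -/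

structure Letter where
  ceil : ℤ
  primed : Bool
deriving DecidableEq, Repr

instance : Inhabited Letter := ⟨⟨0, false⟩⟩

/-- The order `⋯ < 1' < 1 < 2' < 2 < ⋯`. -/
instance : LinearOrder Letter :=
  LinearOrder.lift' (fun x : Letter => toLex (x.ceil, !x.primed))
    (fun a b h => by
      have h' : (a.ceil, !a.primed) = (b.ceil, !b.primed) := toLex.injective h
      obtain ⟨ac, ap⟩ := a
      obtain ⟨bc, bp⟩ := b
      simp only [Prod.mk.injEq] at h'
      obtain ⟨h1, h2⟩ := h'
      cases ap <;> cases bp <;> simp_all)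

/-- A primed word. -/
abbrev PWord := List Letter

def Letter.unprime (x : Letter) : Letter := ⟨x.ceil, false⟩

def Letter.succL (x : Letter) : Letter := ⟨x.ceil + 1, x.primed⟩

/-- `unprime` of a primed word: replace each letter `x` by `⌈x⌉`. -/
def unprimeWord (a : PWord) : List ℤ := a.map Letter.ceil

/-- `unprime` of a primed word, as a primed word with no primes. -/
def unprimeP (a : PWord) : PWord := a.map Letter.unprime

/-! ## Involution words -/

/-- The simple transposition `s_i = (i, i+1)` of `ℤ`. -/
def sPerm (i : ℤ) : Equiv.Perm ℤ := Equiv.swap i (i + 1)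

/-- The Demazure product `s_{w_1} ∘ s_{w_2} ∘ ⋯ ∘ s_{w_k}` of a word, computed by the
defining recursion `σ ∘ s_i = σ·s_i` if `σ(i) < σ(i+1)` and `σ ∘ s_i = σ` otherwise. -/
def heckeProd (w : List ℤ) : Equiv.Perm ℤ :=
  w.foldl (fun σ i => if σ i < σ (i + 1) then σ * sPerm i else σ) 1

/-- `s_{a_n} ∘ ⋯ ∘ s_{a_2} ∘ s_{a_1} ∘ s_{a_2} ∘ ⋯ ∘ s_{a_n}` for `a = a_1 a_2 ⋯ a_n`. -/
def invHecke (a : List ℤ) : Equiv.Perm ℤ := heckeProd (a.reverse ++ a.tail)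

/-- Membership in `I_ℤ`: a finitely supported involution of `ℤ`. -/
def IZ (z : Equiv.Perm ℤ) : Prop := {x : ℤ | z x ≠ x}.Finite ∧ z * z = 1

/-- The set of involution words of `z`. -/
def Rinv (z : Equiv.Perm ℤ) : Set (List ℤ) :=
  {a | invHecke a = z ∧ ∀ b : List ℤ, invHecke b = z → a.length ≤ b.length}

/-- 0-based index `k` is a commutation in the word `a` (this corresponds to the 1-based
index `k+1`): `a_{k+1}` and `a_{k+1} + 1` are both fixed points of
`s_{a_k} ∘ ⋯ ∘ s_{a_1} ∘ ⋯ ∘ s_{a_k}`. -/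
def IsCommutation (a : List ℤ) (k : ℕ) : Prop :=
  ∃ x, a[k]? = some x ∧ invHecke (a.take k) x = x ∧ invHecke (a.take k) (x + 1) = x + 1

/-- The set of primed involution words of `z`. -/
def RinvPlus (z : Equiv.Perm ℤ) : Set PWord :=
  {a | unprimeWord a ∈ Rinv z ∧
     ∀ (k : ℕ) (x : Letter), a[k]? = some x → x.primed = true →
       IsCommutation (unprimeWord a) k}

/-! ## Shifted tableaux.
A shifted tableau is recorded as its list of rows, from the first (bottom) row upward;
the entry at 0-based index `k` of 0-based row `r` occupies the box in row `r+1` and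
column `r+1+k` of the shifted diagram. -/

abbrev STab := List (List Letter)

/-- A strict partition, recorded as its (strictly decreasing) list of positive parts. -/
def IsStrictPartition (sh : List ℕ) : Prop :=
  List.Chain' (fun a b => b < a) sh ∧ ∀ m ∈ sh, 0 < m

def shapeOf {α : Type*} (T : List (List α)) : List ℕ := T.map List.length

/-- The rows form the shifted diagram of a strict partition. -/
def IsShifted {α : Type*} (T : List (List α)) : Prop := IsStrictPartition (shapeOf T)

/-- The entry of `T` in (0-based) row `r` and column `c` of the shifted diagram. -/
def entryG? {α : Type*} (T : List (List α)) (r c : ℕ) : Option α :=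
  if r ≤ c then (T[r]?).bind (fun row => row[c - r]?) else none

def entry? (T : STab) (r c : ℕ) : Option Letter := entryG? T r c

def setRowG {α : Type*} (T : List (List α)) (r : ℕ) (row : List α) : List (List α) :=
  if r < T.length then T.set r row else T ++ [row]

def setEntryG {α : Type*} (T : List (List α)) (r c : ℕ) (x : α) : List (List α) :=
  T.set r ((T.getD r []).set (c - r) x)

def numCols {α : Type*} (T : List (List α)) : ℕ := (T.getD 0 []).length

/-- Row reading word: rows left to right, starting with the last (top) row. -/
def rowWord (T : STab) : PWord := T.reverse.flatten

/-- Column reading word: columns top to bottom, starting with the first column. -/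
def colWord (T : STab) : PWord :=
  (List.range (numCols T)).flatMap (fun c =>
    ((List.range (c + 1)).reverse).filterMap (fun r => entry? T r c))

def unprimeT (T : STab) : STab := T.map (List.map Letter.unprime)

/-- Remove the primes from all main-diagonal entries. -/
def unprimeDiagT (T : STab) : STab :=
  T.map (fun row =>
    match row with
    | [] => []
    | x :: rest => Letter.unprime x :: rest)

/-- Rows and columns are strictly increasing. -/
def IsIncreasing (T : STab) : Prop :=
  (∀ r c x y, entry? T r c = some x → entry? T r (c + 1) = some y → x < y) ∧
  (∀ r c x y, entry? T r c = some x → entry? T (r + 1) c = some y → x < y)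

/-- No primed entries on the main diagonal. -/
def NoDiagPrimes (T : STab) : Prop :=
  ∀ r x, entry? T r r = some x → x.primed = false

/-- Entries positive, rows and columns weakly increasing, no primed entry repeated
in a row and no unprimed entry repeated in a column. -/
def IsSemistandard (T : STab) : Prop :=
  (∀ x ∈ T.flatten, 0 < x.ceil) ∧
  (∀ r c x y, entry? T r c = some x → entry? T r (c + 1) = some y → x ≤ y) ∧
  (∀ r c x y, entry? T r c = some x → entry? T (r + 1) c = some y → x ≤ y) ∧
  (∀ r c c' x, c < c' → entry? T r c = some x → entry? T r c' = some x →
    x.primed = false) ∧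
  (∀ r r' c x, r < r' → entry? T r c = some x → entry? T r' c = some x →
    x.primed = true)

/-- Increasing, with exactly one of `i` or `i'` as an entry for each `i = 1, …, n`,
where `n` is the number of boxes. -/
def IsStandard (T : STab) : Prop :=
  IsIncreasing T ∧
  ∀ i : ℤ, 1 ≤ i → i ≤ (T.flatten.length : ℤ) →
    T.flatten.countP (fun x => decide (x.ceil = i)) = 1
/-! ## Orthogonal Edelman–Greene insertion -/

/-- "Switching the primes" of a pair: reverse the primes on both letters if exactly one
of them is unprimed, and leave them unchanged otherwise. -/
def switchPrimes (x y : Letter) : Letter × Letter :=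
  if x.primed = y.primed then (x, y)
  else (⟨x.ceil, !x.primed⟩, ⟨y.ceil, !y.primed⟩)

/-- Column-insertion stage of orthogonal Edelman–Greene insertion:
insert letter `w` into column `c` of `T` (then continue into later columns). -/
def egCol : ℕ → STab → ℕ → Letter → STab × Bool
  | 0, T, _, _ => (T, true)
  | fuel + 1, T, c, w =>
    let occ := (List.range (c + 1)).filterMap (fun r => (entry? T r c).map (fun x => (r, x)))
    match occ.findIdx? (fun p => decide (w.ceil < p.2.ceil)) with
    | none =>
        -- place `w` in the first empty box of the column
        let r := occ.length
        let w' := if r = c ∧ w.primed then Letter.unprime w else w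
        (setRowG T r ((T.getD r []) ++ [w']), if r = c then w.primed else true)
    | some kM =>
        let km := (occ.findIdx? (fun p => decide (w.ceil ≤ p.2.ceil))).getD kM
        let im := (occ.getD km (0, default)).1
        let m := (occ.getD km (0, default)).2
        if km = kM then
          if im = c then
            -- m = M on the main diagonal
            egCol fuel (setEntryG T im c (Letter.unprime w)) (c + 1) ⟨m.ceil, w.primed⟩
          else
            -- m = M off the main diagonal
            egCol fuel (setEntryG T im c w) (c + 1) m
        else
          -- m < M : switch the primes on m and M, insert w+1 into the next column
          let iM := (occ.getD kM (0, default)).1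
          let M := (occ.getD kM (0, default)).2
          let p := switchPrimes m M
          egCol fuel (setEntryG (setEntryG T im c p.1) iM c p.2) (c + 1) (Letter.succL w)

/-- Row-insertion stage of orthogonal Edelman–Greene insertion:
insert letter `w` into row `r` of `T`. -/
def egRow : ℕ → STab → ℕ → Letter → STab × Bool
  | 0, T, _, _ => (T, true)
  | fuel + 1, T, r, w =>
    let row := T.getD r []
    match row.findIdx? (fun x => decide (w.ceil < x.ceil)) with
    | none =>
        if row.isEmpty ∧ w.primed then (setRowG T r [Letter.unprime w], true)
        else (setRowG T r (row ++ [w]), false)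
    | some kM =>
        let km := (row.findIdx? (fun x => decide (w.ceil ≤ x.ceil))).getD kM
        let m := row.getD km default
        if km = kM then
          if km = 0 then
            -- m = M on the main diagonal
            egCol fuel (setRowG T r (row.set 0 (Letter.unprime w))) (r + 1)
              ⟨m.ceil, w.primed⟩
          else
            -- m = M off the main diagonal
            egRow fuel (setRowG T r (row.set km w)) (r + 1) m
        else
          -- m < M : switch primes; insert w+1 into the next column (if m is on the
          -- main diagonal) or the next row (otherwise)
          let M := row.getD kM default
          let p := switchPrimes m M
          let row' := (row.set km p.1).set kM p.2
          if km = 0 then egCol fuel (setRowG T r row') (r + 1) (Letter.succL w)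
          else egRow fuel (setRowG T r row') (r + 1) (Letter.succL w)

/-- `T ←ᴼ u` together with the flag recording whether the insertion ended in
column insertion. -/
def egInsert (T : STab) (u : Letter) : STab × Bool :=
  egRow (T.flatten.length + T.length + 2) T 0 u

/-- The orthogonal Edelman–Greene insertion tableau `P_EGᴼ(a)`. -/
def PEG (a : PWord) : STab := a.foldl (fun T u => (egInsert T u).1) []

/-- Add the recording letter `x` to `Q` in the unique box of `Pnew` not in `Pold`. -/
def addBox (Q Pold Pnew : STab) (x : Letter) : STab :=
  match (List.range Pnew.length).find?
      (fun r => decide ((Pold.getD r []).length ≠ (Pnew.getD r []).length)) with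
  | some r => setRowG Q r ((Q.getD r []) ++ [x])
  | none => Q

def QEGaux : STab → STab → ℕ → PWord → STab
  | _, Q, _, [] => Q
  | P, Q, n, u :: rest =>
      let res := egInsert P u
      QEGaux res.1 (addBox Q P res.1 ⟨(n : ℤ), res.2⟩) (n + 1) rest

/-- The orthogonal Edelman–Greene recording tableau `Q_EGᴼ(a)`. -/
def QEG (a : PWord) : STab := QEGaux [] [] 1 a

/-! ## Orthogonal Coxeter–Knuth operators -/

def ock1 (x : Letter) : Letter := ⟨x.ceil, !x.primed⟩

def ock2 (x y : Letter) : Letter × Letter := (⟨y.ceil, x.primed⟩, ⟨x.ceil, y.primed⟩)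

def ock3 (x y z : Letter) : Letter × Letter × Letter :=
  if x.ceil = z.ceil ∧ (x.ceil - y.ceil = 1 ∨ y.ceil - x.ceil = 1) then
    if x.primed = false ∧ y.primed = false ∧ z.primed = false then
      -- XYX ↔ YXY
      (⟨y.ceil, false⟩, ⟨x.ceil, false⟩, ⟨y.ceil, false⟩)
    else if x.primed = true ∧ y.primed = false ∧ z.primed = false then
      -- X'YX ↦ YXY'
      (⟨y.ceil, false⟩, ⟨x.ceil, false⟩, ⟨y.ceil, true⟩)
    else if x.primed = false ∧ y.primed = false ∧ z.primed = true then
      -- YXY' ↦ X'YX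
      (⟨y.ceil, true⟩, ⟨x.ceil, false⟩, ⟨y.ceil, false⟩)
    else (x, y, z)
  else if (x.ceil < z.ceil ∧ z.ceil < y.ceil) ∨ (y.ceil < z.ceil ∧ z.ceil < x.ceil) then
    -- ACB ↔ CAB
    (y, x, z)
  else if (y.ceil < x.ceil ∧ x.ceil < z.ceil) ∨ (z.ceil < x.ceil ∧ x.ceil < y.ceil) then
    -- BCA ↔ BAC
    (x, z, y)
  else (x, y, z)

/-- The operator `ock_i` for `i ∈ ℤ`. -/
def ockW (i : ℤ) (a : PWord) : PWord :=
  if i = -1 then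
    match a with
    | [] => []
    | x :: rest => ock1 x :: rest
  else if i = 0 then
    match a with
    | x :: y :: rest => (ock2 x y).1 :: (ock2 x y).2 :: rest
    | _ => a
  else if 1 ≤ i ∧ i + 2 ≤ (a.length : ℤ) then
    let k := (i - 1).toNat
    match a[k]?, a[k + 1]?, a[k + 2]? with
    | some x, some y, some z =>
        a.take k ++ [(ock3 x y z).1, (ock3 x y z).2.1, (ock3 x y z).2.2] ++ a.drop (k + 3)
    | _, _, _ => a
  else a

/-- Orthogonal Coxeter–Knuth equivalence: generated by `a ∼ ock_i(a)` for all `i ∈ ℤ`. -/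
def OckEquiv : PWord → PWord → Prop :=
  Relation.EqvGen (fun a b => ∃ i : ℤ, b = ockW i a)
/-! ## Descents -/

/-- Descent set of a primed word (as a set of 1-based positions). -/
def DesWord (a : PWord) : Set ℤ :=
  {i | ∃ k : ℕ, i = (k : ℤ) + 1 ∧ ∃ x y, a[k]? = some x ∧ a[k + 1]? = some y ∧ y < x}

/-- Descent set of a standard shifted tableau. -/
def DesT (T : STab) : Set ℤ :=
  {i | 0 < i ∧ (
    (∃ r c r' c', entry? T r c = some ⟨i, false⟩ ∧
        entry? T r' c' = some ⟨i + 1, false⟩ ∧ r < r') ∨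
    (∃ r c r' c', entry? T r c = some ⟨i, true⟩ ∧
        entry? T r' c' = some ⟨i + 1, true⟩ ∧ c < c') ∨
    (∃ r c r' c', entry? T r c = some ⟨i, false⟩ ∧
        entry? T r' c' = some ⟨i + 1, true⟩))}

/-! ## Dual equivalence operators on standard shifted tableaux -/

def numPrimes (T : STab) : ℕ := T.flatten.countP (fun x => x.primed)

/-- The entries of column `c`, read from bottom to top (increasing). -/
def colLetters (T : STab) (c : ℕ) : PWord :=
  (List.range (c + 1)).filterMap (fun r => entry? T r c)

/-- The shifted reading word `unprime(C_q R_q ⋯ C_1 R_1)`. -/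
def shword (T : STab) : List ℤ :=
  (((List.range (numCols T)).reverse).flatMap (fun idx =>
    (colLetters T idx).filter (fun x => x.primed) ++
      ((T.getD idx []).filter (fun x => !x.primed)))).map Letter.ceil

def idxOfZ (v : ℤ) : List ℤ → ℕ
  | [] => 0
  | x :: r => if x = v then 0 else idxOfZ v r + 1

def positionsOf (T : STab) : List (ℕ × ℕ) :=
  (List.range T.length).flatMap (fun r =>
    (List.range (T.getD r []).length).map (fun k => (r, r + k)))

/-- The box `□_v` of `T` containing `v` or `v'`. -/
def boxOf (T : STab) (v : ℤ) : Option (ℕ × ℕ) :=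
  (positionsOf T).find? (fun p =>
    match entry? T p.1 p.2 with
    | some x => decide (x.ceil = v)
    | none => false)

/-- Reverse the prime of the entry in position `(r, c)`. -/
def togglePos (T : STab) (r c : ℕ) : STab :=
  match entry? T r c with
  | some x => setEntryG T r c ⟨x.ceil, !x.primed⟩
  | none => T

/-- Switch the primes of the entries in the two given positions. -/
def switchAt (T : STab) (p q : ℕ × ℕ) : STab :=
  match entry? T p.1 p.2, entry? T q.1 q.2 with
  | some x, some y =>
      if x.primed = y.primed then T else togglePos (togglePos T p.1 p.2) q.1 q.2
  | _, _ => T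

/-- The row index of `□_v` if it is a main-diagonal box. -/
def diagBox? (T : STab) (v : ℤ) : Option ℕ :=
  (boxOf T v).bind (fun p => if p.1 = p.2 then some p.1 else none)

def switchDiag (T T' : STab) (u v : ℤ) : STab :=
  match diagBox? T u, diagBox? T v with
  | some r, some s => switchAt T' (r, r) (s, s)
  | _, _ => T'

/-- The operator `𝔰_i`. -/
def sOp (i : ℤ) (T : STab) : STab :=
  match boxOf T i, boxOf T (i + 1) with
  | some (r1, c1), some (r2, c2) =>
      if r1 ≠ r2 ∧ c1 ≠ c2 then
        -- swap i ↔ i+1 and i' ↔ (i+1)'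
        setEntryG (setEntryG T r1 c1 ⟨i + 1, ((entry? T r1 c1).getD default).primed⟩)
          r2 c2 ⟨i, ((entry? T r2 c2).getD default).primed⟩
      else if r1 ≠ c1 ∧ r2 ≠ c2 then
        -- same row or column, neither box diagonal: reverse both primes
        togglePos (togglePos T r1 c1) r2 c2
      else
        -- same row or column, one box diagonal
        let T1 := if r1 = c1 then togglePos T r2 c2 else togglePos T r1 c1
        let T2 :=
          if 1 ≤ i - 1 ∧ (diagBox? T (i - 1)).isSome ∧ (diagBox? T (i + 1)).isSome then
            switchDiag T T1 (i - 1) (i + 1)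
          else T1
        if i + 2 ≤ (T.flatten.length : ℤ) ∧ (diagBox? T i).isSome ∧
            (diagBox? T (i + 2)).isSome then
          switchDiag T T2 i (i + 2)
        else T2
  | _, _ => T

def btwn (a m b : ℕ) : Prop := (a < m ∧ m < b) ∨ (b < m ∧ m < a)

instance (a m b : ℕ) : Decidable (btwn a m b) := by unfold btwn; infer_instance

/-- The dual equivalence operator `𝔡_i` for `i ∈ ℤ`. -/
def dOp (i : ℤ) (T : STab) : STab :=
  if ¬(1 ≤ i + 2 ∧ i + 2 ≤ (T.flatten.length : ℤ)) then T
  else if i = -1 then togglePos T 0 0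
  else if i = 0 then togglePos T 0 1
  else
    let w := shword T
    if btwn (idxOfZ i w) (idxOfZ (i + 2) w) (idxOfZ (i + 1) w) then sOp i T
    else if btwn (idxOfZ (i + 1) w) (idxOfZ i w) (idxOfZ (i + 2) w) then sOp (i + 1) T
    else T

/-! ## Marked cycles -/

/-- The 2-cycles of `z`, as ordered pairs `(i, j)` with `i < j = z(i)`. -/
def cycSet (z : Equiv.Perm ℤ) : Set (ℤ × ℤ) := {p | p.1 < p.2 ∧ z p.1 = p.2}

/-- `s_{a_n} ⋯ s_{a_{k+2}} s_{a_{k+1}}` (ordinary product; 0-based index `k`). -/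
def suffixPerm (a : List ℤ) (k : ℕ) : Equiv.Perm ℤ :=
  ((a.drop (k + 1)).reverse.map sPerm).prod

/-- `γ_{k+1}(a)` as an ordered pair (junk value `(0,0)` off the commutation set). -/
def gammaPair (a : List ℤ) (k : ℕ) : ℤ × ℤ :=
  match a[k]? with
  | some x => (min (suffixPerm a k x) (suffixPerm a k (x + 1)),
               max (suffixPerm a k x) (suffixPerm a k (x + 1)))
  | none => (0, 0)
/-! ## Increasing factorization sequences and Schur Q-functions -/

/-- `Incr_∞(R_inv^+(z))`: sequences of weakly increasing primed words, all but
finitely many empty, whose concatenation is a primed involution word for `z`. -/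
def IncrSeq (z : Equiv.Perm ℤ) : Set (ℕ → PWord) :=
  {φ | (∀ n, List.Chain' (· ≤ ·) (φ n)) ∧
    ∃ N, (∀ n, N ≤ n → φ n = []) ∧ ((List.range N).map φ).flatten ∈ RinvPlus z}

/-- Least bound past which a sequence of words is empty. -/
noncomputable def seqBound (φ : ℕ → PWord) : ℕ := sInf {N | ∀ n, N ≤ n → φ n = []}

/-- The concatenation `a^1 a^2 ⋯` of a sequence of words. -/
noncomputable def concatSeq (φ : ℕ → PWord) : PWord :=
  ((List.range (seqBound φ)).map φ).flatten

/-- `ℓ(a^1) + ⋯ + ℓ(a^i)`. -/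
def prefLen (φ : ℕ → PWord) (i : ℕ) : ℕ := (((List.range i).map φ).map List.length).sum

/-- The minimal `i ≥ 1` with `j ≤ ℓ(a^1) + ⋯ + ℓ(a^i)`. -/
noncomputable def relabel (φ : ℕ → PWord) (j : ℤ) : ℤ :=
  ((sInf {i : ℕ | 1 ≤ i ∧ j ≤ (prefLen φ i : ℤ)} : ℕ) : ℤ)

/-- The semistandard recording tableau `Q_EGᴼ(φ)`. -/
noncomputable def QEGseq (φ : ℕ → PWord) : STab :=
  (QEG (concatSeq φ)).map (List.map (fun x => (⟨relabel φ x.ceil, x.primed⟩ : Letter)))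

/-- The insertion tableau `P_EGᴼ(φ)`. -/
noncomputable def PEGseq (φ : ℕ → PWord) : STab := PEG (concatSeq φ)

/-- The Schur Q-function of a strict partition: the coefficient of the monomial with
exponent vector `d` is the number of semistandard shifted tableaux `T` of the given
shape with `x^T = x^d`. -/
noncomputable def SchurQ (sh : List ℕ) : MvPowerSeries ℤ ℤ :=
  fun d => (({T : STab | shapeOf T = sh ∧ IsSemistandard T ∧
    ∀ i : ℤ, d i = T.flatten.countP (fun x => decide (x.ceil = i))} : Set STab).ncard : ℤ)

/-- `Q_z = Σ_{φ ∈ Incr_∞(R_inv^+(z))} x^φ`. -/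
noncomputable def Qz (z : Equiv.Perm ℤ) : MvPowerSeries ℤ ℤ :=
  fun d => (({φ : ℕ → PWord | φ ∈ IncrSeq z ∧
    (∀ i : ℕ, d ((i : ℤ) + 1) = (φ i).length) ∧
    (∀ j : ℤ, j ≤ 0 → d j = 0)} : Set (ℕ → PWord)).ncard : ℤ)

/-! ## Dominant involutions -/

/-- The shifted diagram `SD_λ ⊆ ℤ × ℤ` of a strict partition. -/
def SDset (sh : List ℕ) : Set (ℤ × ℤ) :=
  {p | ∃ i j : ℕ, 1 ≤ i ∧ i ≤ sh.length ∧ 1 ≤ j ∧ j ≤ sh.getD (i - 1) 0 ∧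
    p.1 = (i : ℤ) ∧ p.2 = (i : ℤ) + (j : ℤ) - 1}

/-- The involution Rothe diagram `D̂(z) = {(i,j) : z(i) > j ≤ i < z(j)}`. -/
def invRothe (z : Equiv.Perm ℤ) : Set (ℤ × ℤ) :=
  {p | p.2 < z p.1 ∧ p.2 ≤ p.1 ∧ p.1 < z p.2}

/-- The tableau `T_λ` with entry `i + j - 1` in box `(i, j)` of `SD_λ`. -/
def Tlam (sh : List ℕ) : STab :=
  (List.range sh.length).map (fun r =>
    (List.range (sh.getD r 0)).map (fun k =>
      (⟨2 * (r : ℤ) + (k : ℤ) + 1, false⟩ : Letter)))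

/-- The permutation `i + m ↦ w(i) + m` (fixing everything outside `m + support`). -/
def shiftPerm (m : ℕ) (w : Equiv.Perm ℤ) : Equiv.Perm ℤ :=
  (Equiv.addLeft (m : ℤ)).permCongr w

/-- `z ∈ S_m`: `z` fixes every point outside `[1, m]`. -/
def SupportedOn (z : Equiv.Perm ℤ) (m : ℕ) : Prop :=
  ∀ x : ℤ, x < 1 ∨ (m : ℤ) < x → z x = x
/-! ## Primed compatible sequences -/

/-- A primed compatible sequence, recorded as the list of its columns `(index; value)`. -/
def IsPrimedCompatible (φ : List (ℕ × Letter)) : Prop :=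
  (∀ p ∈ φ, 0 < p.1 ∧ 0 < p.2.ceil) ∧
  List.Chain' (fun p q : ℕ × Letter => p.1 ≤ q.1 ∧ (p.1 = q.1 → p.2 ≤ q.2)) φ ∧
  (∀ (k l : ℕ) (p : ℕ × Letter), k < l → φ[k]? = some p → φ[l]? = some p →
    p.2.primed = false)

def IsIndexStrict (φ : List (ℕ × Letter)) : Prop :=
  List.Chain' (fun p q : ℕ × Letter => p.1 < q.1) φ

/-! ## Sagan–Worley insertion (orthogonal and symplectic versions) -/

/-- Whether `u` bumps `v`: strict comparison when inserting an unprimed letter into a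
row or a primed letter into a column, weak comparison otherwise. -/
def swBump (isRow : Bool) (u v : Letter) : Bool :=
  if (isRow && !u.primed) || (!isRow && u.primed) then decide (u < v) else decide (u ≤ v)

/-- Column stage of orthogonal Sagan–Worley insertion. -/
def swColO : ℕ → STab → ℕ → Letter → STab × Bool
  | 0, T, _, _ => (T, true)
  | fuel + 1, T, c, u =>
    let occ := (List.range (c + 1)).filterMap (fun r => (entry? T r c).map (fun x => (r, x)))
    match occ.find? (fun p => swBump false u p.2) with
    | none =>
        let r := occ.length
        let u' := if r = c ∧ u.primed then Letter.unprime u else u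
        (setRowG T r ((T.getD r []) ++ [u']), true)
    | some p =>
        if p.1 = c then
          if u.ceil = p.2.ceil then swColO fuel T (c + 1) (Letter.unprime p.2)
          else
            let q := switchPrimes u p.2
            swColO fuel (setEntryG T p.1 c q.1) (c + 1) q.2
        else swColO fuel (setEntryG T p.1 c u) (c + 1) p.2

/-- Row stage of orthogonal Sagan–Worley insertion. -/
def swRowO : ℕ → STab → ℕ → Letter → STab × Bool
  | 0, T, _, _ => (T, true)
  | fuel + 1, T, r, u =>
    let row := T.getD r []
    match row.findIdx? (fun v => swBump true u v) with
    | none =>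
        if row.isEmpty ∧ u.primed then (setRowG T r [Letter.unprime u], true)
        else (setRowG T r (row ++ [u]), false)
    | some k =>
        let v := row.getD k default
        if k = 0 then
          if u.ceil = v.ceil then swColO fuel T (r + 1) (Letter.unprime v)
          else
            let q := switchPrimes u v
            swColO fuel (setRowG T r (row.set 0 q.1)) (r + 1) q.2
        else swRowO fuel (setRowG T r (row.set k u)) (r + 1) v

def swInsertO (T : STab) (u : Letter) : STab × Bool :=
  swRowO (T.flatten.length + T.length + 2) T 0 u

/-- Column stage of symplectic (original) Sagan–Worley insertion. -/
def swColSp : ℕ → STab → ℕ → Letter → STab × Bool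
  | 0, T, _, _ => (T, true)
  | fuel + 1, T, c, u =>
    let occ := (List.range (c + 1)).filterMap (fun r => (entry? T r c).map (fun x => (r, x)))
    match occ.find? (fun p => swBump false u p.2) with
    | none => (setRowG T occ.length ((T.getD occ.length []) ++ [u]), true)
    | some p =>
        if p.1 = c then
          if u.ceil = p.2.ceil then swColSp fuel T (c + 1) (Letter.unprime p.2)
          else swColSp fuel (setEntryG T p.1 c u) (c + 1) p.2
        else swColSp fuel (setEntryG T p.1 c u) (c + 1) p.2

/-- Row stage of symplectic (original) Sagan–Worley insertion. -/
def swRowSp : ℕ → STab → ℕ → Letter → STab × Bool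
  | 0, T, _, _ => (T, true)
  | fuel + 1, T, r, u =>
    let row := T.getD r []
    match row.findIdx? (fun v => swBump true u v) with
    | none => (setRowG T r (row ++ [u]), false)
    | some k =>
        let v := row.getD k default
        if k = 0 then
          if u.ceil = v.ceil then swColSp fuel T (r + 1) (Letter.unprime v)
          else swColSp fuel (setRowG T r (row.set 0 u)) (r + 1) v
        else swRowSp fuel (setRowG T r (row.set k u)) (r + 1) v

def swInsertSp (T : STab) (u : Letter) : STab × Bool :=
  swRowSp (T.flatten.length + T.length + 2) T 0 u

def PSWO (φ : List (ℕ × Letter)) : STab := φ.foldl (fun T p => (swInsertO T p.2).1) []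

def PSWSp (φ : List (ℕ × Letter)) : STab := φ.foldl (fun T p => (swInsertSp T p.2).1) []

def QSWaux (ins : STab → Letter → STab × Bool) : STab → STab → List (ℕ × Letter) → STab
  | _, Q, [] => Q
  | P, Q, p :: rest =>
      let res := ins P p.2
      QSWaux ins res.1 (addBox Q P res.1 ⟨(p.1 : ℤ), res.2⟩) rest

def QSWO (φ : List (ℕ × Letter)) : STab := QSWaux swInsertO [] [] φ

def QSWSp (φ : List (ℕ × Letter)) : STab := QSWaux swInsertSp [] [] φ

/-- Entry `A_{ij}` of the circled matrix of `φ` (forgetting the circles). -/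
def cmEntry (φ : List (ℕ × Letter)) (i j : ℕ) : ℕ :=
  φ.countP (fun p => decide (p.1 = i ∧ p.2.ceil = (j : ℤ)))

/-! ## Shifted mixed insertion (orthogonal and symplectic versions) -/

/-- Tableaux whose entries are signed letters `(ε, u)`, `ε ∈ {+, -}`
(`true` records the sign `-`). -/
abbrev MTab := List (List (Bool × Letter))

def extractO (U : MTab) : STab :=
  U.map (fun row =>
    match row with
    | [] => []
    | (e, x) :: rest => (if e then (⟨x.ceil, true⟩ : Letter) else x) :: rest.map Prod.snd)

def extractSp (U : MTab) : STab := U.map (List.map Prod.snd)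

/-- One mixed insertion, of the pair `β` into row (`isCol = false`) or column
(`isCol = true`) number `idx`; returns the tableau and the added box. -/
def hmIns (sympl : Bool) : ℕ → MTab → Bool → ℕ → Bool × Letter → MTab × (ℕ × ℕ)
  | 0, T, _, _, _ => (T, (0, 0))
  | fuel + 1, T, isCol, idx, β =>
    if isCol then
      let c := idx
      let occ := (List.range (c + 1)).filterMap
        (fun r => (entryG? T r c).map (fun x => (r, x)))
      match occ.find? (fun p => decide (β.2 < p.2.2)) with
      | none =>
          let r := occ.length
          (setRowG T r ((T.getD r []) ++ [β]), (r, c))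
      | some p =>
          if p.1 = c then
            hmIns sympl fuel
              (setEntryG T p.1 c (if sympl then (p.2.1, β.2) else β)) true (c + 1)
              (if sympl then (β.1, ⟨p.2.2.ceil, true⟩) else (p.2.1, ⟨p.2.2.ceil, true⟩))
          else
            hmIns sympl fuel (setEntryG T p.1 c (p.2.1, β.2)) p.2.2.primed
              (if p.2.2.primed then c + 1 else p.1 + 1) (β.1, p.2.2)
    else
      let r := idx
      let row := T.getD r []
      match row.findIdx? (fun p => decide (β.2 < p.2)) with
      | none => (setRowG T r (row ++ [β]), (r, r + row.length))
      | some k =>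
          let q := row.getD k default
          if k = 0 then
            hmIns sympl fuel
              (setRowG T r (row.set 0 (if sympl then (q.1, β.2) else β))) true (r + 1)
              (if sympl then (β.1, ⟨q.2.ceil, true⟩) else (q.1, ⟨q.2.ceil, true⟩))
          else
            hmIns sympl fuel (setRowG T r (row.set k (q.1, β.2))) q.2.primed
              (if q.2.primed then r + k + 1 else r + 1) (β.1, q.2)

def hmInsert (sympl : Bool) (T : MTab) (x : Letter) : MTab × (ℕ × ℕ) :=
  hmIns sympl (2 * T.flatten.length + 4) T false 0 (x.primed, ⟨x.ceil, false⟩)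

def hmAuxCS (sympl : Bool) : MTab → STab → List (ℕ × Letter) → MTab × STab
  | U, Q, [] => (U, Q)
  | U, Q, p :: rest =>
      let res := hmInsert sympl U p.2
      let pos := res.2
      let sgn := ((entryG? res.1 pos.1 pos.2).map Prod.fst).getD false
      let pr : Bool := if sympl then sgn else (decide (pos.1 ≠ pos.2) && sgn)
      hmAuxCS sympl res.1
        (setRowG Q pos.1 ((Q.getD pos.1 []) ++ [(⟨(p.1 : ℤ), pr⟩ : Letter)])) rest

def PHMO (φ : List (ℕ × Letter)) : STab := extractO (hmAuxCS false [] [] φ).1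
def QHMO (φ : List (ℕ × Letter)) : STab := (hmAuxCS false [] [] φ).2
def PHMSp (φ : List (ℕ × Letter)) : STab := extractSp (hmAuxCS true [] [] φ).1
def QHMSp (φ : List (ℕ × Letter)) : STab := (hmAuxCS true [] [] φ).2

/-- A primed word, identified with the primed compatible sequence with
index row `1, 2, …, n`. -/
def wordCS (a : PWord) : List (ℕ × Letter) :=
  ((List.range a.length).zip a).map (fun p => (p.1 + 1, p.2))

/-! ## The transpose of a primed compatible sequence -/

def insSortedCS (p : ℕ × Letter) : List (ℕ × Letter) → List (ℕ × Letter)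
  | [] => [p]
  | q :: rest =>
      if p.1 < q.1 ∨ (p.1 = q.1 ∧ p.2 ≤ q.2) then p :: q :: rest
      else q :: insSortedCS p rest

def sortCS (l : List (ℕ × Letter)) : List (ℕ × Letter) := l.foldr insSortedCS []

/-- `φ^⊤`: move each prime from the value to the index above it, interchange the two
rows, and reorder the columns lexicographically. -/
def transposeCS (φ : List (ℕ × Letter)) : List (ℕ × Letter) :=
  sortCS (φ.map (fun p => (p.2.ceil.toNat, (⟨(p.1 : ℤ), p.2.primed⟩ : Letter))))

/-- A chain of boxes with letters: the boxes of a shifted tableau listed in the reverse of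
the order in which they are added. -/
abbrev BoxChain := List ((ℕ × ℕ) × Letter)

/-- `e` and `h` are the row lengths and column heights of a common shifted diagram. -/
def IsShape (e h : ℕ → ℕ) : Prop := ∀ r c, r < h c ↔ r ≤ c ∧ c < r + e r

def AddableTo (e h : ℕ → ℕ) (x : ℕ × ℕ) : Prop := x.2 = x.1 + e x.1 ∧ h x.2 = x.1

def RemovableFrom (e h : ℕ → ℕ) (x : ℕ × ℕ) : Prop := x.2 + 1 = x.1 + e x.1 ∧ h x.2 = x.1 + 1

def plusRow (e : ℕ → ℕ) (x : ℕ × ℕ) : ℕ → ℕ := fun r => e r + if x.1 = r then 1 else 0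

def plusCol (h : ℕ → ℕ) (x : ℕ × ℕ) : ℕ → ℕ := fun c => h c + if x.2 = c then 1 else 0

namespace IsShape

variable {e h : ℕ → ℕ} {x y z : ℕ × ℕ}

theorem plus (H : IsShape e h) (hx : AddableTo e h x) :
    IsShape (plusRow e x) (plusCol h x) := by
  intro r c
  obtain ⟨a, b⟩ := x
  obtain ⟨h1, h2⟩ := hx
  simp only at h1 h2
  have h3 := H r c
  simp only [plusRow, plusCol]
  by_cases hr : a = r <;> by_cases hc : b = c <;> simp only [hr, hc, if_true, if_false] <;>
    first | omega | (subst hr; omega) | (subst hc; omega) | (subst hr; subst hc; omega)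

theorem addable_trichotomy (H : IsShape e h) (hx : AddableTo e h x) (hy : AddableTo e h y) :
    x = y ∨ (x.1 < y.1 ∧ y.2 < x.2) ∨ (y.1 < x.1 ∧ x.2 < y.2) := by
  obtain ⟨a, b⟩ := x
  obtain ⟨c, d⟩ := y
  obtain ⟨h1, h2⟩ := hx
  obtain ⟨h3, h4⟩ := hy
  simp only at h1 h2 h3 h4
  have h5 := H a d
  have h6 := H c b
  rcases lt_trichotomy a c with h7 | h7 | h7
  · right; left; simp only; omega
  · left; subst h7; simp; omega
  · right; right; simp only; omega

theorem addable_le (hx : AddableTo e h x) : x.1 ≤ x.2 := by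
  have := hx.1; omega

theorem mem_addable (H : IsShape e h) (hz : z.1 < h z.2) (hy : AddableTo e h y) :
    z.1 ≤ z.2 ∧ (z.1 < y.1 ∨ z.2 < y.2) := by
  obtain ⟨h1, h2⟩ := hy
  have h3 := H z.1 z.2
  have h4 := H y.1 z.2
  omega

theorem row_target (H : IsShape e h) (hx : RemovableFrom e h x) (hd : x.1 < x.2) :
    AddableTo e h (x.1 + 1, x.1 + 1 + e (x.1 + 1)) ∧ x.1 + 1 + e (x.1 + 1) ≤ x.2 := by
  obtain ⟨h1, h2⟩ := hx
  have h3 := H (x.1 + 1) x.2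
  have h4 := H x.1 (x.1 + 1 + e (x.1 + 1))
  have h5 := H (x.1 + 1) (x.1 + 1 + e (x.1 + 1))
  refine ⟨⟨rfl, ?_⟩, ?_⟩
  · simp only; omega
  · omega

theorem col_target (H : IsShape e h) (hx : RemovableFrom e h x) :
    AddableTo e h (h (x.2 + 1), x.2 + 1) ∧ h (x.2 + 1) ≤ x.1 := by
  obtain ⟨h1, h2⟩ := hx
  have h3 := H x.1 (x.2 + 1)
  have h4 := H (h (x.2 + 1)) (x.2 + 1)
  have h5 := H (h (x.2 + 1)) x.2
  have h6 := H x.1 x.2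
  refine ⟨⟨?_, rfl⟩, ?_⟩
  · simp only; omega
  · omega

theorem removable_plus (hx : AddableTo e h x) :
    RemovableFrom (plusRow e x) (plusCol h x) x := by
  obtain ⟨h1, h2⟩ := hx
  simp only [RemovableFrom, plusRow, plusCol, if_true]
  omega

theorem addable_plus (hx : AddableTo e h x) (hy : AddableTo e h y) (hxy : x ≠ y)
    (H : IsShape e h) : AddableTo (plusRow e x) (plusCol h x) y := by
  have h1 := H.addable_trichotomy hx hy
  obtain ⟨h2, h3⟩ := hy
  simp only [AddableTo, plusRow, plusCol]
  rcases h1 with h1 | h1 | h1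
  · exact absurd h1 hxy
  · rw [if_neg (by omega), if_neg (by omega)]; exact ⟨h2, h3⟩
  · rw [if_neg (by omega), if_neg (by omega)]; exact ⟨h2, h3⟩

end IsShape

/-- The order in which two equal letters with given primes (or two equal indices with given
flags) must occupy boxes. -/
def BoxPrec (x : ℕ × ℕ) (f : Bool) (y : ℕ × ℕ) (g : Bool) : Prop :=
  (f = true ∧ (g = false ∨ x.1 < y.1)) ∨ (f = false ∧ g = false ∧ x.2 < y.2)

/-- A letter with prime `p` displaced from box `x` by an insertion with flag `f` moves to `y`,
with new prime `q` and new flag `g`; `d` tells whether the displacing letter on the diagonal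
has a different ceiling. -/
def BumpRel (x : ℕ × ℕ) (f p d : Bool) (y : ℕ × ℕ) (g q : Bool) : Prop :=
  (x.1 = x.2 ∧ y.1 ≤ x.1 ∧ y.2 = x.2 + 1 ∧ g = true ∧ q = (f && d)) ∨
  (x.1 < x.2 ∧ f = true ∧ y.1 ≤ x.1 ∧ y.2 = x.2 + 1 ∧ g = true ∧ q = p) ∨
  (x.1 < x.2 ∧ f = false ∧ y.1 = x.1 + 1 ∧ y.2 ≤ x.2 ∧ y.1 < y.2 ∧ g = false ∧ q = p) ∨
  (x.1 < x.2 ∧ f = false ∧ y.1 = x.1 + 1 ∧ y.2 = y.1 ∧ g = p ∧ q = false)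

/-- One step of the recursion: `(x, p)` is a box with its prime, `(b, f)` the new box and flag
below it; `(y, q)` and `(b', f')` are the updated values. -/
def StepRel (x : ℕ × ℕ) (p d : Bool) (b : ℕ × ℕ) (f : Bool)
    (y : ℕ × ℕ) (q : Bool) (b' : ℕ × ℕ) (f' : Bool) : Prop :=
  (b ≠ x ∧ y = x ∧ q = p ∧ b' = b ∧ f' = f) ∨ (b = x ∧ b' = y ∧ BumpRel x f p d y f' q)

def Incomparable (x y : ℕ × ℕ) : Prop := (x.1 < y.1 ∧ y.2 < x.2) ∨ (y.1 < x.1 ∧ x.2 < y.2)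

set_option linter.unusedSimpArgs false in
set_option linter.unusedVariables false in
set_option maxHeartbeats 1600000 in
/-- Recording letters: the order of two successive new boxes is not affected by a step. -/
theorem boxPrec_step_recording {x b₁ b₂ x₁ x₂ b₁' b₂' : ℕ × ℕ}
    {p d₁ d₂ f₁ f₂ q₁ q₂ f₁' f₂' : Bool}
    (hs₁ : StepRel x p d₁ b₁ f₁ x₁ q₁ b₁' f₁') (hs₂ : StepRel x₁ q₁ d₂ b₂ f₂ x₂ q₂ b₂' f₂')
    (hx : x.1 ≤ x.2) (hb₁ : b₁.1 ≤ b₁.2) (hb₂ : b₂.1 ≤ b₂.2) (hx₁ : x₁.1 ≤ x₁.2)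
    (h₁ : x = b₁ ∨ Incomparable x b₁) (h₂ : x₁ = b₂ ∨ Incomparable x₁ b₂)
    (h₃ : b₁.1 < b₂.1 ∨ b₁.2 < b₂.2) (h₄ : x₁ = b₂ → b₁.1 < x₂.1 ∨ b₁.2 < x₂.2) :
    BoxPrec b₁ f₁ b₂ f₂ ↔ BoxPrec b₁' f₁' b₂' f₂' := by
  obtain ⟨x, x'⟩ := x
  obtain ⟨b, b'⟩ := b₁
  obtain ⟨c, c'⟩ := b₂
  obtain ⟨y, y'⟩ := x₁
  obtain ⟨z, z'⟩ := x₂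
  simp only [StepRel, BumpRel, BoxPrec, Incomparable, Prod.mk.injEq, ne_eq] at *
  rcases hs₁ with ⟨a1, ⟨a2, a2'⟩, a3, a4, a5⟩ | ⟨⟨a1, a1'⟩, a2, a3⟩ <;>
  rcases hs₂ with ⟨c1, ⟨c2, c2'⟩, c3, c4, c5⟩ | ⟨⟨c1, c1'⟩, c2, c3⟩
  · subst_vars; simp_all
  all_goals
    cases p <;> cases f₁ <;> cases f₁' <;> cases f₂ <;> cases f₂' <;> cases q₁ <;>
      simp_all <;> omega

set_option linter.unusedSimpArgs false in
set_option linter.unusedVariables false in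
set_option maxHeartbeats 1600000 in
/-- Tableau letters: the order of two equal letters is not affected by a step. -/
theorem boxPrec_step_letters {x₁ x₂ b b₁ b₂ y₁ y₂ : ℕ × ℕ}
    {p₁ p₂ d₁ d₂ f f₁ f₂ q₁ q₂ : Bool}
    (hs₁ : StepRel x₁ p₁ d₁ b f y₁ q₁ b₁ f₁) (hs₂ : StepRel x₂ p₂ d₂ b₁ f₁ y₂ q₂ b₂ f₂)
    (hx₁ : x₁.1 ≤ x₁.2) (hx₂ : x₂.1 ≤ x₂.2) (hb : b.1 ≤ b.2) (hb₁ : b₁.1 ≤ b₁.2)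
    (hp₁ : x₁.1 = x₁.2 → p₁ = false) (hp₂ : x₂.1 = x₂.2 → p₂ = false)
    (h₁ : x₁ = b ∨ Incomparable x₁ b) (h₂ : x₂ = b₁ ∨ Incomparable x₂ b₁)
    (h₃ : x₁.1 < x₂.1 ∨ x₁.2 < x₂.2) (h₄ : x₂ = b₁ → x₁.1 < y₂.1 ∨ x₁.2 < y₂.2)
    (hd : b = x₁ → b₁ = x₂ → d₂ = false)
    (hf : b₁ = x₂ → x₂.1 = x₂.2 → d₂ = false → f₁ = true) :
    BoxPrec x₁ p₁ x₂ p₂ ↔ BoxPrec y₁ q₁ y₂ q₂ := by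
  obtain ⟨x, x'⟩ := x₁
  obtain ⟨b, b'⟩ := b
  obtain ⟨c, c'⟩ := b₁
  obtain ⟨y, y'⟩ := x₂
  obtain ⟨w, w'⟩ := y₁
  obtain ⟨z, z'⟩ := y₂
  simp only [StepRel, BumpRel, BoxPrec, Incomparable, Prod.mk.injEq, ne_eq] at *
  rcases hs₁ with ⟨a1, ⟨a2, a2'⟩, a3, a4, a5⟩ | ⟨⟨a1, a1'⟩, a2, a3⟩ <;>
  rcases hs₂ with ⟨c1, ⟨c2, c2'⟩, c3, c4, c5⟩ | ⟨⟨c1, c1'⟩, c2, c3⟩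
  · subst_vars; simp_all
  all_goals
    cases p₁ <;> cases p₂ <;> cases f <;> cases d₁ <;> cases d₂ <;> cases f₁ <;> cases q₁ <;>
      cases q₂ <;> simp only [reduceCtorEq, false_and, and_false, false_or, or_false, true_and, and_true,
        Bool.and_self, Bool.and_true, Bool.and_false, Bool.true_and, Bool.false_and, iff_false,
        false_iff, iff_true, true_iff, implies_true, IsEmpty.forall_iff, iff_self, imp_false, true_or, or_true,
        not_true_eq_false, not_false_eq_true] at * <;> omega

namespace Letter

theorem lt_iff (a b : Letter) :
    a < b ↔ a.ceil < b.ceil ∨ (a.ceil = b.ceil ∧ a.primed = true ∧ b.primed = false) := by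
  change toLex (a.ceil, !a.primed) < toLex (b.ceil, !b.primed) ↔ _
  rw [Prod.Lex.toLex_lt_toLex]
  cases a.primed <;> cases b.primed <;> simp

theorem le_iff (a b : Letter) :
    a ≤ b ↔ a.ceil < b.ceil ∨ (a.ceil = b.ceil ∧ (a.primed = true ∨ b.primed = false)) := by
  change toLex (a.ceil, !a.primed) ≤ toLex (b.ceil, !b.primed) ↔ _
  rw [Prod.Lex.toLex_le_toLex]
  cases a.primed <;> cases b.primed <;> simp

theorem ext_iff' {a b : Letter} : a = b ↔ a.ceil = b.ceil ∧ a.primed = b.primed := by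
  cases a; cases b; simp

/-- `m.Tri u`: the letter `u` may follow `m` in a row. -/
def Tri (m u : Letter) : Prop := m.ceil < u.ceil ∨ (m.ceil = u.ceil ∧ u.primed = false)

instance (m u : Letter) : Decidable (m.Tri u) := by unfold Tri; infer_instance

theorem swBump_true (u v : Letter) : swBump true u v = true ↔ ¬ v.Tri u := by
  unfold swBump Tri
  cases h : u.primed <;> simp [lt_iff, le_iff, h] <;> omega

theorem swBump_false (u v : Letter) : swBump false u v = true ↔ u.Tri v := by
  unfold swBump Tri
  cases h : u.primed <;> simp [lt_iff, le_iff, h]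

end Letter

def rowLen (P : BoxChain) (r : ℕ) : ℕ := P.countP (fun p => p.1.1 = r)

def colLen (P : BoxChain) (c : ℕ) : ℕ := P.countP (fun p => p.1.2 = c)

@[simp] theorem rowLen_nil (r : ℕ) : rowLen [] r = 0 := rfl

@[simp] theorem colLen_nil (c : ℕ) : colLen [] c = 0 := rfl

theorem rowLen_cons (p : (ℕ × ℕ) × Letter) (P : BoxChain) :
    rowLen (p :: P) = plusRow (rowLen P) p.1 := by
  funext r; simp [rowLen, plusRow, List.countP_cons]

theorem colLen_cons (p : (ℕ × ℕ) × Letter) (P : BoxChain) :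
    colLen (p :: P) = plusCol (colLen P) p.1 := by
  funext r; simp [colLen, plusCol, List.countP_cons]

theorem plusRow_comm (e : ℕ → ℕ) (x y : ℕ × ℕ) :
    plusRow (plusRow e x) y = plusRow (plusRow e y) x := by
  funext r; simp only [plusRow]; omega

theorem plusCol_comm (e : ℕ → ℕ) (x y : ℕ × ℕ) :
    plusCol (plusCol e x) y = plusCol (plusCol e y) x := by
  funext r; simp only [plusCol]; omega

/-- The box `x` may be added to the diagram of `P`. -/
def BoxChain.Addable (P : BoxChain) (x : ℕ × ℕ) : Prop := AddableTo (rowLen P) (colLen P) x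

/-- Every box of the chain is addable to the boxes before it. -/
def BoxChain.Built : BoxChain → Prop
  | [] => True
  | p :: P => BoxChain.Built P ∧ BoxChain.Addable P p.1

def BoxChain.NoDiag (P : BoxChain) : Prop := ∀ p ∈ P, p.1.1 = p.1.2 → p.2.primed = false

/-- The order of consecutive boxes in a chain. -/
def BoxLt (p q : (ℕ × ℕ) × Letter) : Prop :=
  p.2.ceil < q.2.ceil ∨ (p.2.ceil = q.2.ceil ∧ BoxPrec p.1 p.2.primed q.1 q.2.primed)

def BoxChain.HeadLt (P : BoxChain) (q : (ℕ × ℕ) × Letter) : Prop := ∀ p ∈ P.head?, BoxLt p q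

def BoxChain.Ordered : BoxChain → Prop
  | [] => True
  | p :: P => BoxChain.Ordered P ∧ BoxChain.HeadLt P p

theorem BoxLt.trans {p q r : (ℕ × ℕ) × Letter} (h1 : BoxLt p q) (h2 : BoxLt q r) : BoxLt p r := by
  unfold BoxLt BoxPrec at *
  rcases h1 with h1 | ⟨h1, h1'⟩ <;> rcases h2 with h2 | ⟨h2, h2'⟩
  · left; omega
  · left; omega
  · left; omega
  · right
    refine ⟨by omega, ?_⟩
    rcases h1' with ⟨a, b⟩ | ⟨a, b, c⟩ <;> rcases h2' with ⟨a', b'⟩ | ⟨a', b', c'⟩ <;>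
      simp_all
    · rcases b' with b' | b'
      · exact Or.inl b'
      · exact Or.inr (by omega)
    · omega

theorem BoxChain.Ordered.forall_lt {P : BoxChain} {q : (ℕ × ℕ) × Letter} (h : P.Ordered)
    (hq : P.HeadLt q) : ∀ p ∈ P, BoxLt p q := by
  induction P generalizing q with
  | nil => simp
  | cons a P ih =>
    have ha : BoxLt a q := hq a (by simp)
    intro p hp
    rcases List.mem_cons.1 hp with rfl | hp
    · exact ha
    · exact (ih h.1 h.2 p hp).trans ha

namespace BoxChain

variable {P : BoxChain} {x y z : ℕ × ℕ}

theorem Built.isShape : ∀ {P : BoxChain}, P.Built → IsShape (rowLen P) (colLen P)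
  | [], _ => by intro r c; simp
  | p :: P, h => by
    rw [rowLen_cons, colLen_cons]
    exact (Built.isShape h.1).plus h.2

theorem Addable.le (hx : P.Addable x) : x.1 ≤ x.2 := IsShape.addable_le hx

theorem Built.trichotomy (H : P.Built) (hx : P.Addable x) (hy : P.Addable y) :
    x = y ∨ Incomparable x y := by
  rcases H.isShape.addable_trichotomy hx hy with h | h | h
  · exact Or.inl h
  · exact Or.inr (Or.inl h)
  · exact Or.inr (Or.inr h)

theorem Built.lt_colLen : ∀ {P : BoxChain}, P.Built → ∀ p ∈ P, p.1.1 < colLen P p.1.2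
  | [], _, p, hp => by simp at hp
  | q :: P, h, p, hp => by
    rw [colLen_cons]
    simp only [plusCol]
    rcases List.mem_cons.1 hp with rfl | hp
    · have := h.2.2
      simp; omega
    · have := Built.lt_colLen h.1 p hp
      omega

theorem Built.mem_addable (H : P.Built) {p : (ℕ × ℕ) × Letter} (hp : p ∈ P) (hy : P.Addable y) :
    p.1.1 < y.1 ∨ p.1.2 < y.2 := (H.isShape.mem_addable (H.lt_colLen p hp) hy).2

theorem Built.mem_le (H : P.Built) {p : (ℕ × ℕ) × Letter} (hp : p ∈ P) : p.1.1 ≤ p.1.2 :=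
  ((H.isShape _ _).1 (H.lt_colLen p hp)).1

theorem Built.not_mem_addable (H : P.Built) {l : Letter} (hy : P.Addable y) : (y, l) ∉ P := by
  intro h
  have := H.mem_addable h hy
  simp at this

theorem Built.rowLen_zero_pos {p : (ℕ × ℕ) × Letter} (H : BoxChain.Built (p :: P)) :
    0 < rowLen (p :: P) 0 := by
  have h := H.lt_colLen p (by simp)
  have h1 := H.isShape 0 p.1.2
  omega

theorem Built.addable_row_zero (H : P.Built) : P.Addable (0, rowLen P 0) := by
  have h1 := H.isShape 0 (rowLen P 0)
  refine ⟨by simp, ?_⟩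
  simp only; omega

theorem Addable.eq_zero (hx : BoxChain.Addable [] x) : x = (0, 0) := by
  obtain ⟨a, b⟩ := x
  have h1 := hx.1
  have h2 := hx.2
  simp at h1 h2 ⊢; omega

/-- Whether box `x` carries a letter with ceiling `k`. -/
def occurs (P : BoxChain) (x : ℕ × ℕ) (k : ℤ) : Bool := P.any (fun p => p.1 = x ∧ p.2.ceil = k)

theorem occurs_iff {k : ℤ} : P.occurs x k = true ↔ ∃ l : Letter, (x, l) ∈ P ∧ l.ceil = k := by
  simp only [occurs, List.any_eq_true, decide_eq_true_eq]
  constructor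
  · rintro ⟨⟨y, l⟩, h1, rfl, h2⟩; exact ⟨l, h1, h2⟩
  · rintro ⟨l, h1, h2⟩; exact ⟨(x, l), h1, rfl, h2⟩

/-- Where the letter `m` in the box `x` goes when displaced, with its updated value and flag. -/
def bumpTo (P : BoxChain) (x : ℕ × ℕ) (m : Letter) (f : Bool) : (ℕ × ℕ) × Letter × Bool :=
  if x.1 = x.2 then
    ((colLen P (x.2 + 1), x.2 + 1), ⟨m.ceil, f && !P.occurs x m.ceil⟩, true)
  else if f then ((colLen P (x.2 + 1), x.2 + 1), m, true)
  else if rowLen P (x.1 + 1) = 0 then ((x.1 + 1, x.1 + 1), m.unprime, m.primed)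
  else ((x.1 + 1, x.1 + 1 + rowLen P (x.1 + 1)), m, false)

/-- Update of the last box `(x, m)` when the insertion below adds box `b` with flag `f`. -/
def Step (P : BoxChain) (x : ℕ × ℕ) (m : Letter) (b : ℕ × ℕ) (f : Bool) (y : ℕ × ℕ) (m' : Letter)
    (b' : ℕ × ℕ) (f' : Bool) : Prop :=
  (b ≠ x ∧ y = x ∧ m' = m ∧ b' = b ∧ f' = f) ∨ (b = x ∧ bumpTo P x m f = (y, m', f') ∧ b' = y)

/-- Insertion of a letter into a chain; the result is a chain, the new box and the flag telling
whether insertion ended in column insertion. -/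
inductive Ins : BoxChain → Letter → BoxChain → ℕ × ℕ → Bool → Prop
  | nil (u : Letter) : Ins [] u [((0, 0), u.unprime)] (0, 0) u.primed
  | place {x : ℕ × ℕ} {m u : Letter} {P : BoxChain} (h : m.Tri u) :
      Ins ((x, m) :: P) u (((0, rowLen ((x, m) :: P) 0), u) :: (x, m) :: P)
        (0, rowLen ((x, m) :: P) 0) false
  | step {x y b b' : ℕ × ℕ} {m m' u : Letter} {f f' : Bool} {P P₁ : BoxChain} (h : ¬ m.Tri u)
      (hP : Ins P u P₁ b f) (hs : Step P₁ x m b f y m' b' f') :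
      Ins ((x, m) :: P) u ((y, m') :: P₁) b' f'

theorem exists_ins : ∀ (P : BoxChain) (u : Letter), ∃ P' b f, Ins P u P' b f
  | [], u => ⟨_, _, _, Ins.nil u⟩
  | (x, m) :: P, u => by
    by_cases h : m.Tri u
    · exact ⟨_, _, _, Ins.place h⟩
    · obtain ⟨P₁, b, f, h1⟩ := exists_ins P u
      by_cases hb : b = x
      · exact ⟨_, _, _, Ins.step h h1 (Or.inr ⟨hb, rfl, rfl⟩)⟩
      · exact ⟨_, _, _, Ins.step h h1 (Or.inl ⟨hb, rfl, rfl, rfl, rfl⟩)⟩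

variable {P₁ P' : BoxChain} {m m' u v : Letter} {b b' : ℕ × ℕ} {f f' : Bool}

theorem Step.ceil_eq (hs : Step P₁ x m b f y m' b' f') : m'.ceil = m.ceil := by
  rcases hs with ⟨_, _, rfl, _⟩ | ⟨_, h, _⟩
  · rfl
  · unfold bumpTo at h
    split_ifs at h <;> simp only [Prod.mk.injEq] at h <;> obtain ⟨_, rfl, _⟩ := h <;> rfl

/-- The shape of `P₁` is that of `P` with the box `b` added. -/
def Extends (P P₁ : BoxChain) (b : ℕ × ℕ) : Prop :=
  rowLen P₁ = plusRow (rowLen P) b ∧ colLen P₁ = plusCol (colLen P) b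

theorem Step.stepRel (hs : Step P₁ x m b f y m' b' f') (H : P.Built) (hx : P.Addable x)
    (hE : Extends P P₁ b) :
    StepRel x m.primed (!P₁.occurs x m.ceil) b f y m'.primed b' f' := by
  rcases hs with ⟨h1, h2, rfl, h3, h4⟩ | ⟨rfl, h, h2⟩
  · exact Or.inl ⟨h1, h2, rfl, h3, h4⟩
  · refine Or.inr ⟨rfl, h2, ?_⟩
    have hle := hx.le
    have hsh := H.isShape.plus hx
    have hrem := IsShape.removable_plus hx
    rw [← hE.1, ← hE.2] at hsh hrem
    have hcol := hsh.col_target hrem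
    unfold bumpTo at h
    unfold BumpRel
    split_ifs at h with h3 h4 h5 <;> simp only [Prod.mk.injEq] at h <;> obtain ⟨rfl, rfl, rfl⟩ := h
    · left; exact ⟨h3, hcol.2, rfl, rfl, rfl⟩
    · right; left
      exact ⟨by omega, h4, hcol.2, rfl, rfl, rfl⟩
    · right; right; right
      exact ⟨by omega, by simpa using h4, rfl, rfl, rfl, rfl⟩
    · right; right; left
      have := hsh.row_target hrem (by omega)
      exact ⟨by omega, by simpa using h4, rfl, this.2, by simp only; omega, rfl, rfl⟩

theorem Step.addable (hs : Step P₁ x m b f y m' b' f') (H : P.Built) (hx : P.Addable x)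
    (hb : P.Addable b) (hE : Extends P P₁ b) :
    P₁.Addable y ∧ BoxChain.Addable ((x, m) :: P) b' ∧
      Extends ((x, m) :: P) ((y, m') :: P₁) b' := by
  unfold Addable Extends at *
  simp only [rowLen_cons, colLen_cons]
  rcases hs with ⟨h1, rfl, rfl, rfl, rfl⟩ | ⟨rfl, h, rfl⟩
  · rw [hE.1, hE.2]
    exact ⟨IsShape.addable_plus hb hx h1 H.isShape,
      IsShape.addable_plus hx hb (Ne.symm h1) H.isShape, plusRow_comm _ _ _, plusCol_comm _ _ _⟩
  · rw [← hE.1, ← hE.2]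
    suffices h5 : AddableTo (rowLen P₁) (colLen P₁) b' from ⟨h5, h5, rfl, rfl⟩
    have hle := IsShape.addable_le hx
    have hsh := H.isShape.plus hx
    have hrem := IsShape.removable_plus hx
    rw [← hE.1, ← hE.2] at hsh hrem
    have hcol := hsh.col_target hrem
    unfold bumpTo at h
    split_ifs at h with h3 h4 h5 <;> simp only [Prod.mk.injEq] at h <;> obtain ⟨rfl, rfl, rfl⟩ := h
    · exact hcol.1
    · exact hcol.1
    · have := (hsh.row_target hrem (by omega)).1
      rw [h5] at this
      exact this
    · exact (hsh.row_target hrem (by omega)).1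

theorem Ins.built (h : Ins P u P' b f) (H : P.Built) :
    P.Addable b ∧ Extends P P' b ∧ P'.Built := by
  induction h with
  | nil u =>
    have h0 : BoxChain.Addable [] (0, 0) := ⟨rfl, rfl⟩
    exact ⟨h0, ⟨rowLen_cons _ _, colLen_cons _ _⟩, trivial, h0⟩
  | place h => exact ⟨H.addable_row_zero, ⟨rowLen_cons _ _, colLen_cons _ _⟩, H, H.addable_row_zero⟩
  | step h hP hs ih =>
    obtain ⟨h1, h2, h3⟩ := ih H.1
    obtain ⟨h4, h5, h6⟩ := hs.addable H.1 H.2 h1 h2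
    exact ⟨h5, h6, h3, h4⟩

theorem Ins.noDiag (h : Ins P u P' b f) (H : P.Built) (hN : P.NoDiag) : P'.NoDiag := by
  induction h with
  | nil u => intro p hp; simp at hp; subst hp; intro _; rfl
  | place h =>
    intro p hp
    rcases List.mem_cons.1 hp with rfl | hp
    · have := H.rowLen_zero_pos
      intro h2; simp only at h2; omega
    · exact hN p hp
  | step h hP hs ih =>
    obtain ⟨h1, h2, h3⟩ := hP.built H.1
    intro p hp
    rcases List.mem_cons.1 hp with rfl | hp
    · have h5 := hs.stepRel H.1 H.2 h2
      have h6 := H.2.le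
      have h7 := hN _ (List.mem_cons_self)
      rcases h5 with ⟨h8, h9, h10, _⟩ | ⟨h8, h9, h10 | h10 | h10 | h10⟩
      · simp only at h7 ⊢; rw [h9, h10]; exact h7
      all_goals simp only at h6 ⊢; intro h11
      · omega
      · omega
      · omega
      · exact h10.2.2.2.2.2
    · exact ih H.1 (fun p hp => hN p (List.mem_cons_of_mem _ hp)) p hp

end BoxChain

namespace BoxChain

variable {P P₁ P₂ P' : BoxChain} {m m' m₁ m₂ u v : Letter} {x y z b b' x₁ x₂ b₁ b₂ : ℕ × ℕ}
  {f f' f₁ f₂ : Bool}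

/-- The comparison between the letter that an insertion leaves in its new box and the letter that
was there. -/
def Displaces (b : ℕ × ℕ) (f : Bool) (e m : Letter) : Prop :=
  if b.1 = b.2 then (if f then e.ceil ≤ m.ceil else e.ceil < m.ceil)
  else (if f then e.Tri m else ¬ m.Tri e)

theorem Ins.displaces (h : Ins P u P₁ b f) (H : P.Built) (hN : P.NoDiag) {m e : Letter}
    (hm : ∀ q ∈ P, BoxLt q (b, m)) (hu : ¬ m.Tri u) (hd : b.1 = b.2 → m.primed = false)
    (he : (b, e) ∈ P₁) : Displaces b f e m := by
  induction h with
  | nil u =>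
    simp only [List.mem_singleton, Prod.mk.injEq, true_and] at he
    subst he
    unfold Letter.Tri at hu
    cases h : u.primed <;> simp [Displaces, Letter.unprime, h] at hu hd ⊢ <;> omega
  | place h =>
    rcases List.mem_cons.1 he with he | he
    · simp only [Prod.mk.injEq, true_and] at he
      subst he
      have := H.rowLen_zero_pos
      rw [Displaces, if_neg (by simp only; omega), if_neg (by simp)]
      exact hu
    · exact absurd he (H.not_mem_addable H.addable_row_zero)
  | @step x1 y1 b0 b1 m1 m1' u f0 f1 P0 P0' h hP hs ih =>
    obtain ⟨h1, h2, h3⟩ := hP.built H.1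
    have hy := (hs.addable H.1 H.2 h1 h2).1
    have hN0 : NoDiag P0 := fun p hp => hN p (List.mem_cons_of_mem _ hp)
    have hm1 := hm _ (List.mem_cons_self)
    have hN1 := hN _ (List.mem_cons_self)
    have hle := H.2.le
    have hc := hs.ceil_eq
    have hr := hs.stepRel H.1 H.2 h2
    rcases hr with ⟨h5, h6, h7, h8, h9⟩ | ⟨h5, h6, hr⟩
    · subst h6 h8 h9
      rcases List.mem_cons.1 he with he | he
      · simp only [Prod.mk.injEq] at he
        exact absurd he.1 h5
      · exact ih H.1 hN0 (fun q hq => hm q (List.mem_cons_of_mem _ hq)) hu hd he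
    · subst h6
      have he' : e = m1' := by
        rcases List.mem_cons.1 he with he | he
        · simpa using he
        · exact absurd he (h3.not_mem_addable hy)
      subst he'
      clear ih he hs hm hu h hP
      simp only [BoxLt, BoxPrec, BumpRel, Displaces, Letter.Tri] at *
      by_cases hd' : b1.1 = b1.2
      · rw [if_pos hd']
        have hd := hd hd'
        cases hq : m1.primed <;> cases hf : f0 <;> cases hg : f1 <;>
          simp [hq, hf, hg, hd, hc] at hm1 hr hN1 ⊢ <;> omega
      · rw [if_neg hd']
        cases hq : m1.primed <;> cases hf : f0 <;> cases hg : f1 <;> cases hpm : m.primed <;>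
          cases he : e.primed <;>
          simp [hq, hf, hg, hc, hpm, he] at hm1 hr hN1 ⊢ <;> omega

theorem step_headLt_iff (h : Ins P u P₁ b f) (H : P.Built) (hN : P.NoDiag)
    (hx : P.Addable x) (hp : x.1 = x.2 → m.primed = false)
    (hf : b = x → x.1 = x.2 → P₁.occurs x m.ceil = true → f = true)
    (hs : Step P₁ x m b f y m' b' f') :
    (¬ m.Tri u ∧ P.HeadLt (x, m)) ↔ P₁.HeadLt (y, m') := by
  obtain ⟨h1, h2, h3⟩ := h.built H
  have hy := (hs.addable H hx h1 h2).1
  have hr := hs.stepRel H hx h2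
  have hc := hs.ceil_eq
  have hle := hx.le
  cases h with
  | nil u =>
    have h0 := hx.eq_zero
    subst h0
    simp only [HeadLt, List.head?_nil, List.head?_cons, Option.mem_def, Option.some.injEq,
      forall_eq', reduceCtorEq, false_implies, implies_true, and_true]
    have hocc : occurs [((0, 0), u.unprime)] (0, 0) m.ceil = decide (u.ceil = m.ceil) := by
      simp [occurs, Letter.unprime]
    rw [hocc] at hr hf
    simp only [StepRel, BumpRel, BoxLt, BoxPrec, Letter.Tri, Letter.unprime] at *
    by_cases he : u.ceil = m.ceil
    · have hu : u.primed = true := hf trivial trivial (by simp [he])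
      simp [he, hu, hc] at hr ⊢
      simp [hr]
    · simp [hc, he]
      omega
  | @place x2 m2 _ P2 h =>
    have hl := H.rowLen_zero_pos
    set l := rowLen ((x2, m2) :: P2) 0
    have htri := H.trichotomy hx h1
    obtain ⟨xr, xc⟩ := x
    simp only [HeadLt, List.head?_cons, Option.mem_def, Option.some.injEq, forall_eq']
    simp only [StepRel, BumpRel, BoxLt, BoxPrec, Letter.Tri, Incomparable, Prod.ext_iff] at *
    cases hq : m.primed <;> cases hu : u.primed <;> cases hm : m'.primed <;>
      cases hm2 : m2.primed <;> simp [hq, hu, hc, hm] at * <;> omega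
  | @step x1 y1 b0 _ m1 m1' _ f0 _ P0 P0' h hP hs1 =>
    obtain ⟨g1, g2, g3⟩ := hP.built H.1
    have gy := (hs1.addable H.1 H.2 g1 g2).1
    have gr := hs1.stepRel H.1 H.2 g2
    have gc := hs1.ceil_eq
    have gle := H.2.le
    have gN := hN _ (List.mem_cons_self)
    simp only at gN gle
    simp only [HeadLt, List.head?_cons, Option.mem_def, Option.some.injEq, forall_eq']
    have key : BoxLt (x1, m1) (x, m) ↔ BoxLt (y1, m1') (y, m') := by
      simp only [BoxLt, gc, hc]
      by_cases hcc : m1.ceil = m.ceil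
      · simp only [hcc, true_and]
        refine or_congr Iff.rfl (boxPrec_step_letters gr hr gle hle g1.le h1.le gN hp
          (H.1.trichotomy H.2 g1) (H.trichotomy hx h1) ?_ ?_ ?_ ?_)
        · exact H.mem_addable (p := (x1, m1)) (by simp) hx
        · intro _
          have h7 : x1.1 < colLen ((y1, m1') :: P0') x1.2 := by
            have := H.lt_colLen (x1, m1) (by simp)
            rw [h2.2]; simp only [plusCol] at this ⊢; omega
          exact (h3.isShape.mem_addable h7 hy).2
        · intro h8 h9
          subst h8
          rcases hs1 with hs1 | hs1
          · exact absurd rfl hs1.1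
          · have : y1 = x := hs1.2.2.symm.trans h9
            simp only [Bool.not_eq_false']
            rw [occurs_iff]
            exact ⟨m1', by simp [this], by omega⟩
        · intro h8 h9 h10
          exact hf h8 h9 (by simpa using h10)
      · simp [hcc]
    rw [← key]
    constructor
    · exact fun h => h.2
    · refine fun h4 => ⟨?_, h4⟩
      unfold BoxLt at h4
      unfold Letter.Tri at *
      cases hu : u.primed <;> simp [hu] at h h4 ⊢ <;> omega

theorem Ordered.tail_lt {p : (ℕ × ℕ) × Letter} (h : Ordered (p :: P)) : ∀ q ∈ P, BoxLt q p :=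
  h.1.forall_lt h.2

theorem Ins.flag_of_occurs (h : Ins P u P₁ b f) (H : P.Built) (hN : P.NoDiag)
    (hm : ∀ q ∈ P, BoxLt q (b, m)) (hu : ¬ m.Tri u) (hd : b.1 = b.2)
    (hp : m.primed = false) (ho : P₁.occurs b m.ceil = true) : f = true := by
  obtain ⟨e, he, hc⟩ := occurs_iff.1 ho
  have := h.displaces H hN hm hu (fun _ => hp) he
  rw [Displaces, if_pos hd] at this
  cases f
  · simp at this; omega
  · rfl

theorem NoDiag.tail {p : (ℕ × ℕ) × Letter} (h : NoDiag (p :: P)) : NoDiag P :=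
  fun q hq => h q (List.mem_cons_of_mem _ hq)

theorem Ins.ordered (h : Ins P u P' b f) (H : P.Built) (hN : P.NoDiag) (hO : P.Ordered) :
    P'.Ordered := by
  induction h with
  | nil u => exact ⟨trivial, by simp [HeadLt]⟩
  | place h =>
    refine ⟨hO, ?_⟩
    simp only [HeadLt, List.head?_cons, Option.mem_def, Option.some.injEq, forall_eq']
    unfold BoxLt
    rcases h with h | ⟨h, h'⟩
    · exact Or.inl h
    · refine Or.inr ⟨h, ?_⟩
      simp only [BoxPrec, h', true_and]
      rename_i x m u P
      cases hm : m.primed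
      · right
        have h1 := H.addable_row_zero
        have h2 := H.mem_addable (p := (x, m)) (by simp) h1
        simp at h2 ⊢; omega
      · simp
  | @step x y b0 b1 m m' u f0 f1 P0 P0' h hP hs ih =>
    refine ⟨ih H.1 hN.tail hO.1, ?_⟩
    refine (step_headLt_iff hP H.1 hN.tail H.2 (hN _ List.mem_cons_self) ?_ hs).1 ⟨h, hO.2⟩
    intro h1 h2 h3
    subst h1
    exact hP.flag_of_occurs H.1 hN.tail hO.tail_lt h h2 (hN _ List.mem_cons_self h2) h3

theorem Ins.tri_iff (h₁ : Ins P u P₁ b₁ f₁) (h₂ : Ins P₁ v P₂ b₂ f₂) (H : P.Built) :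
    u.Tri v ↔ BoxPrec b₁ f₁ b₂ f₂ := by
  induction h₁ generalizing P₂ b₂ f₂ with
  | nil u =>
    cases h₂ with
    | place h =>
      simp only [Letter.Tri, BoxPrec, Letter.unprime, rowLen_cons, plusRow] at *
      cases u.primed <;> simp <;> exact h
    | step h hP hs =>
      cases hP with
      | nil =>
        have hr := hs.stepRel (P := []) trivial ⟨rfl, rfl⟩ ⟨rowLen_cons _ _, colLen_cons _ _⟩
        simp only [Letter.Tri, BoxPrec, Letter.unprime, StepRel, BumpRel] at *
        simp at hr
        simp [hr] at h ⊢
        exact h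
  | @place x m u P h =>
    have h1 := H.addable_row_zero
    have hl := H.rowLen_zero_pos
    cases h₂ with
    | place h2 =>
      simp only [rowLen_cons _ ((x, m) :: P)]
      simp only [h2, BoxPrec, plusRow, true_iff]
      simp
    | @step _ _ b0 _ _ m' _ f0 _ _ P1' h2 hP hs =>
      obtain ⟨g1, g2, g3⟩ := hP.built H
      have hr := hs.stepRel H h1 g2
      have htri := H.trichotomy h1 g1
      simp only [h2, false_iff]
      set l := rowLen ((x, m) :: P) 0
      clear_value l
      clear hs g2 h2
      obtain ⟨br, bc⟩ := b0
      simp only [StepRel, BumpRel, BoxPrec, Incomparable, Prod.mk.injEq] at *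
      cases f0 <;> cases f₂ <;> simp [Prod.ext_iff] at *
      omega
  | @step x x₁ b0 b₁ m m₁ u f0 f₁ P P0' h hP hs ih =>
    obtain ⟨g1, g2, g3⟩ := hP.built H.1
    have gr := hs.stepRel H.1 H.2 g2
    have gc := hs.ceil_eq
    obtain ⟨k1, k2, k3⟩ := (Ins.step h hP hs).built H
    cases h₂ with
    | place h2 =>
      have h3 : u.Tri v := by
        unfold Letter.Tri at *
        cases hu : u.primed <;> cases hv : v.primed <;> simp [hu, hv, gc] at h h2 ⊢ <;> omega
      simp only [h3, true_iff]
      have h4 : b₁.1 < colLen ((x₁, m₁) :: P0') b₁.2 := by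
        have := k1.2
        rw [k2.2]; simp only [plusCol, if_true]; omega
      have h5 := k3.isShape 0 b₁.2
      simp only [BoxPrec]
      cases f₁ <;> simp; omega
    | @step _ x₂ b0' _ _ m₂ _ f0' _ _ P0'' h2 hP2 hs2 =>
      rw [ih hP2 H.1]
      obtain ⟨j1, j2, j3⟩ := hP2.built g3
      have hy := (hs.addable H.1 H.2 g1 g2).1
      have jr := hs2.stepRel g3 hy j2
      have hy2 := (hs2.addable g3 hy j1 j2).1
      have hb : b0.1 < colLen P0' b0.2 := by
        have := g1.2
        rw [g2.2]; simp only [plusCol, if_true]; omega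
      refine boxPrec_step_recording gr jr H.2.le g1.le j1.le hy.le (H.1.trichotomy H.2 g1)
        (g3.trichotomy hy j1) (g3.isShape.mem_addable hb j1).2 ?_
      intro _
      refine (j3.isShape.mem_addable ?_ hy2).2
      rw [j2.2]; simp only [plusCol]; omega

end BoxChain

namespace IsShape

variable {e h : ℕ → ℕ} {x y b : ℕ × ℕ}

theorem removable_of_plus (hy : AddableTo e h y)
    (hb : RemovableFrom (plusRow e y) (plusCol h y) b) (hne : b ≠ y) : RemovableFrom e h b := by
  obtain ⟨h1, h2⟩ := hy
  obtain ⟨h3, h4⟩ := hb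
  simp only [plusRow, plusCol] at h3 h4
  have h5 : y.1 ≠ b.1 := by
    intro h6
    rw [if_pos h6, ← h6] at h3
    exact hne (Prod.ext h6.symm (by omega))
  rw [if_neg h5] at h3
  have h7 : y.2 ≠ b.2 := by
    intro h6
    rw [if_pos h6, ← h6] at h4
    omega
  rw [if_neg h7] at h4
  exact ⟨h3, h4⟩

theorem addable_of_plus (hy : AddableTo (plusRow e b) (plusCol h b) y)
    (hr : RemovableFrom (plusRow e b) (plusCol h b) b)
    (hr' : RemovableFrom (plusRow (plusRow e b) y) (plusCol (plusCol h b) y) b) :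
    AddableTo e h y := by
  obtain ⟨h1, h2⟩ := hy
  have h3 := hr'.1
  have h4 := hr'.2
  have h5 := hr.1
  have h6 := hr.2
  simp only [plusRow, plusCol] at *
  have h8 : b.1 ≠ y.1 := by
    intro h9
    rw [if_pos h9.symm] at h3
    omega
  have h7 : b.2 ≠ y.2 := by
    intro h9
    rw [if_pos h9.symm] at h4
    omega
  rw [if_neg h8] at h1
  rw [if_neg h7] at h2
  exact ⟨h1, h2⟩

theorem removable_row_above (H : IsShape e h) {r : ℕ} (hy : AddableTo e h y) (hr : y.1 = r + 1) :
    RemovableFrom e h (r, r + e r - 1) ∧ r < r + e r - 1 ∧ y.2 ≤ r + e r - 1 := by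
  obtain ⟨h1, h2⟩ := hy
  have h3 := H r y.2
  have h4 := H r (r + e r - 1)
  have h5 := H (r + 1) (r + e r - 1)
  rw [hr] at h1
  refine ⟨⟨?_, ?_⟩, ?_, ?_⟩ <;> (try simp only) <;> omega

theorem removable_col_left (H : IsShape e h) {c : ℕ} (hy : AddableTo e h y) (hc : y.2 = c + 1)
    (hlt : y.1 < y.2) : RemovableFrom e h (h c - 1, c) := by
  obtain ⟨h1, h2⟩ := hy
  have h3 := H y.1 c
  have h4 := H (h c - 1) c
  have h5 := H (h c - 1) (c + 1)
  rw [hc] at h2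
  refine ⟨?_, ?_⟩ <;> simp only <;> omega

end IsShape

namespace BoxChain

variable {P P₁ P₂ P' Q : BoxChain} {m m' u v : Letter} {x y b b' : ℕ × ℕ} {f f' : Bool}

def Valid (P : BoxChain) : Prop := P.Built ∧ P.NoDiag ∧ P.Ordered

def Removable (P : BoxChain) (x : ℕ × ℕ) : Prop := RemovableFrom (rowLen P) (colLen P) x

theorem valid_nil : Valid [] := ⟨trivial, by simp [NoDiag], trivial⟩

theorem Valid.tail {p : (ℕ × ℕ) × Letter} (h : Valid (p :: P)) : Valid P :=
  ⟨h.1.1, h.2.1.tail, h.2.2.1⟩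

theorem Ins.valid (h : Ins P u P' b f) (H : P.Valid) : P'.Valid :=
  ⟨(h.built H.1).2.2, h.noDiag H.1 H.2.1, h.ordered H.1 H.2.1 H.2.2⟩

theorem Ins.ceil_perm (h : Ins P u P' b f) :
    (P'.map (fun p => p.2.ceil)).Perm (u.ceil :: P.map (fun p => p.2.ceil)) := by
  induction h with
  | nil u => simp [Letter.unprime]
  | place h => simp
  | step h hP hs ih =>
    simp only [List.map_cons, hs.ceil_eq]
    exact (ih.cons _).trans (List.Perm.swap _ _ _)

theorem Ins.length_eq (h : Ins P u P' b f) : P'.length = P.length + 1 := by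
  simpa using h.ceil_perm.length_eq

theorem Ins.unstep (h : Ins P u P₁ b f) (hV' : Valid ((y, m') :: P₁)) (hV : P.Valid)
    (hx : P.Addable x) (hs : Step P₁ x m b f y m' b' f') (hp : x.1 = x.2 → m.primed = false)
    (hf : b = x → x.1 = x.2 → P₁.occurs x m.ceil = true → f = true) :
    Valid ((x, m) :: P) ∧ Ins ((x, m) :: P) u ((y, m') :: P₁) b' f' := by
  obtain ⟨h1, h2⟩ := (step_headLt_iff h hV.1 hV.2.1 hx hp hf hs).2 hV'.2.2.2
  refine ⟨⟨⟨hV.1, hx⟩, ?_, ⟨hV.2.2, h2⟩⟩, Ins.step h1 h hs⟩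
  intro p hp'
  rcases List.mem_cons.1 hp' with rfl | hp'
  · exact hp
  · exact hV.2.1 p hp'

theorem exists_bump (hV : Valid ((y, m') :: P₁)) (hP : P₁ ≠ []) (hf : f' = false → y.1 ≠ 0) :
    ∃ x m f, Removable P₁ x ∧ (x.1 = x.2 → m.primed = false) ∧
      bumpTo P₁ x m f = (y, m', f') ∧ (x.1 = x.2 → occurs P₁ x m.ceil = true → f = true) := by
  have hy : Addable P₁ y := hV.1.2
  have hsh := hV.tail.1.isShape
  have hle := hy.le
  have hy1 := hy.1
  have hy2 := hy.2
  obtain ⟨k, hk, hm'⟩ : ∃ k p, m' = ⟨k, p⟩ := ⟨_, _, rfl⟩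
  subst hm'
  have h0 : 0 < rowLen P₁ 0 := by
    cases P₁ with
    | nil => exact absurd rfl hP
    | cons q P₂ => exact hV.1.1.rowLen_zero_pos
  have hN := hV.2.1 _ List.mem_cons_self
  simp only at hN
  obtain ⟨y1, y2⟩ := y
  simp only at hle hy1 hy2 hN hf
  rcases Nat.lt_or_ge y1 y2 with hlt | hge
  · cases f' with
    | false =>
      obtain ⟨r, rfl⟩ := Nat.exists_eq_succ_of_ne_zero (hf rfl)
      obtain ⟨h1, h2, h3⟩ := hsh.removable_row_above hy (r := r) rfl
      refine ⟨_, ⟨k, hk⟩, false, h1, fun h => ?_, ?_, fun h => ?_⟩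
      · simp only at h; omega
      · rw [bumpTo, if_neg (by simp only; omega), if_neg (by simp),
          if_neg (by simp only; simp only [Nat.succ_eq_add_one] at *; omega)]
        simp only [Nat.succ_eq_add_one] at *
        rw [← hy1]
      · simp only at h; omega
    | true =>
      obtain ⟨c, rfl⟩ : ∃ c, y2 = c + 1 := ⟨y2 - 1, by omega⟩
      have h1 := hsh.removable_col_left hy rfl hlt
      by_cases hd : colLen P₁ c - 1 = c
      · rw [hd] at h1
        refine ⟨_, ⟨k, false⟩, hk || occurs P₁ (c, c) k, h1, fun _ => rfl, ?_, fun _ h => ?_⟩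
        · rw [bumpTo, if_pos rfl]
          simp only [hy2]
          cases hk with
          | false => simp
          | true =>
            have : occurs P₁ (c, c) k = false := by
              rw [Bool.eq_false_iff, ne_eq, occurs_iff]
              rintro ⟨l, h3, h4⟩
              have h5 := hV.2.2.tail_lt _ h3
              have h6 := hV.tail.2.1 _ h3 rfl
              simp only [BoxLt, BoxPrec] at h5 h6
              simp [h6] at h5
              omega
            simp [this]
        · simp only at h; simp [h]
      · have := hsh (colLen P₁ c - 1) c
        refine ⟨_, ⟨k, hk⟩, true, h1, fun h => absurd h hd, ?_, fun _ _ => rfl⟩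
        rw [bumpTo, if_neg hd, if_pos rfl]
        simp only [hy2]
  · obtain rfl : y1 = y2 := by omega
    obtain ⟨r, rfl⟩ : ∃ r, y1 = r + 1 := ⟨y1 - 1, by
      rcases Nat.eq_zero_or_pos y1 with rfl | h
      · omega
      · omega⟩
    obtain ⟨h1, h2, h3⟩ := hsh.removable_row_above hy (r := r) rfl
    refine ⟨_, ⟨k, f'⟩, false, h1, fun h => ?_, ?_, fun h => ?_⟩
    · simp only at h; omega
    · rw [bumpTo, if_neg (by simp only; omega), if_neg (by simp), if_pos (by simp only; omega)]
      simp [Letter.unprime, hN]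
    · simp only at h; omega

/-- Every valid chain with a removable box and a flag is the result of an insertion. -/
theorem exists_ins_eq : ∀ (P' : BoxChain), P'.Valid → ∀ b, P'.Removable b → ∀ f,
    ∃ P u, Valid P ∧ Ins P u P' b f := by
  intro P'
  induction P' with
  | nil => intro _ b hb; have := hb.2; simp at this
  | cons q P₁ ih =>
    obtain ⟨y, m'⟩ := q
    intro hV b hb f'
    have hP₁ := hV.tail
    have hy : Addable P₁ y := hV.1.2
    have hsh := hP₁.1.isShape
    have hN := hV.2.1 _ List.mem_cons_self
    simp only at hN
    by_cases hby : b = y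
    · subst hby
      by_cases hP : P₁ = []
      · subst hP
        have := hy.eq_zero
        subst this
        refine ⟨[], ⟨m'.ceil, f'⟩, valid_nil, ?_⟩
        have h2 : m' = Letter.unprime ⟨m'.ceil, f'⟩ := by
          rw [Letter.ext_iff']; exact ⟨rfl, hN rfl⟩
        conv => enter [3]; rw [h2]
        exact Ins.nil ⟨m'.ceil, f'⟩
      · by_cases hf : f' = false ∧ b.1 = 0
        · obtain ⟨rfl, h0⟩ := hf
          obtain ⟨⟨z, l⟩, P₂, rfl⟩ := List.exists_cons_of_ne_nil hP
          have hb1 : b = (0, rowLen ((z, l) :: P₂) 0) := by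
            have := hy.1
            rw [h0] at this
            exact Prod.ext h0 (by simpa using this)
          refine ⟨_, m', hP₁, ?_⟩
          have hlt : BoxLt (z, l) (b, m') := hV.2.2.tail_lt _ (by simp)
          rw [hb1]
          refine Ins.place ?_
          rcases hlt with h | ⟨h, h'⟩
          · exact Or.inl h
          · refine Or.inr ⟨h, ?_⟩
            rcases h' with ⟨_, h' | h'⟩ | ⟨_, h', _⟩
            · exact h'
            · simp only at h'; omega
            · exact h'
        · obtain ⟨x, m, f, hx, hm, hB, ho⟩ := exists_bump hV hP (fun h h' => hf ⟨h, h'⟩)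
          obtain ⟨P, u, hV', hI⟩ := ih hP₁ x hx f
          exact ⟨_, _, hI.unstep hV hV' (hI.built hV'.1).1 (Or.inr ⟨rfl, hB, rfl⟩) hm
            (fun _ => ho)⟩
    · have hb' : Removable P₁ b := by
        unfold Removable at hb
        rw [rowLen_cons, colLen_cons] at hb
        exact IsShape.removable_of_plus hy hb hby
      obtain ⟨P, u, hP, hI⟩ := ih hP₁ b hb' f'
      obtain ⟨h1, h2, h3⟩ := hI.built hP.1
      have hyP : P.Addable y := by
        unfold Removable Addable at *
        rw [rowLen_cons, colLen_cons] at hb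
        rw [h2.1, h2.2] at hb hy hb'
        exact IsShape.addable_of_plus hy hb' hb
      exact ⟨_, _, hI.unstep hV hP hyP (Or.inl ⟨hby, rfl, rfl, rfl, rfl⟩) hN
        (fun h => absurd h hby)⟩

theorem bumpTo_source (H : P.Built) (h : bumpTo P x m f = (y, m', f')) (hx : P.Removable x) :
    (y.1 < y.2 → f' = true → y.2 = x.2 + 1 ∧ (x.1 < x.2 → f = true)) ∧
      (y.1 = y.2 ∨ f' = false → y.1 = x.1 + 1 ∧ x.1 < x.2 ∧ f = false) := by
  have hc := H.isShape
  have e3 := (hc.col_target hx).2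
  have h7 : x.1 ≤ x.2 := by
    have := hc x.1 x.2; have := hx.1; have := hx.2; omega
  unfold bumpTo at h
  split_ifs at h with h1 h2 h3 <;> simp only [Prod.mk.injEq] at h <;> obtain ⟨rfl, rfl, rfl⟩ := h
  · simp; omega
  · simp [h2]; omega
  · simp at h2; simp [h2]; omega
  · simp at h2; simp [h2]; omega

/-- The source of a displacement is determined by its target. -/
theorem bumpTo_inj {x₁ x₂ : ℕ × ℕ} {m₁ m₂ : Letter} {f₁ f₂ : Bool} (H : P.Built)
    (h₁ : bumpTo P x₁ m₁ f₁ = (y, m', f')) (h₂ : bumpTo P x₂ m₂ f₂ = (y, m', f'))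
    (hx₁ : P.Removable x₁) (hx₂ : P.Removable x₂)
    (hm₁ : x₁.1 = x₁.2 → m₁.primed = false) (hm₂ : x₂.1 = x₂.2 → m₂.primed = false)
    (ho₁ : x₁.1 = x₁.2 → P.occurs x₁ m₁.ceil = true → f₁ = true)
    (ho₂ : x₂.1 = x₂.2 → P.occurs x₂ m₂.ceil = true → f₂ = true) :
    x₁ = x₂ ∧ m₁ = m₂ ∧ f₁ = f₂ := by
  have s₁ := bumpTo_source H h₁ hx₁
  have s₂ := bumpTo_source H h₂ hx₂
  have hle : y.1 ≤ y.2 := by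
    have := (H.isShape.col_target hx₁).2
    have h7 : x₁.1 ≤ x₁.2 := by
      have := H.isShape x₁.1 x₁.2; have := hx₁.1; have := hx₁.2; omega
    unfold bumpTo at h₁
    split_ifs at h₁ <;> simp only [Prod.mk.injEq] at h₁ <;> obtain ⟨rfl, -⟩ := h₁ <;>
      simp only <;> omega
  have hxx : x₁ = x₂ := by
    obtain ⟨a₁, c₁⟩ := x₁
    obtain ⟨a₂, c₂⟩ := x₂
    obtain ⟨h3, h4⟩ := hx₁
    obtain ⟨h5, h6⟩ := hx₂
    simp only at *
    by_cases hy : y.1 < y.2 ∧ f' = true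
    · obtain rfl : c₁ = c₂ := by
        have := (s₁.1 hy.1 hy.2).1
        have := (s₂.1 hy.1 hy.2).1
        omega
      obtain rfl : a₁ = a₂ := by omega
      rfl
    · have hy' : y.1 = y.2 ∨ f' = false := by
        cases f'
        · exact Or.inr rfl
        · simp at hy; left; omega
      obtain rfl : a₁ = a₂ := by
        have := (s₁.2 hy').1
        have := (s₂.2 hy').1
        omega
      obtain rfl : c₁ = c₂ := by omega
      rfl
  subst hxx
  refine ⟨rfl, ?_⟩
  obtain ⟨k₁, p₁⟩ := m₁
  obtain ⟨k₂, p₂⟩ := m₂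
  simp only at hm₁ hm₂ ho₁ ho₂
  have hff : x₁.1 < x₁.2 → f₁ = f₂ := by
    intro hlt
    by_cases hy : y.1 < y.2 ∧ f' = true
    · rw [(s₁.1 hy.1 hy.2).2 hlt, (s₂.1 hy.1 hy.2).2 hlt]
    · have hy' : y.1 = y.2 ∨ f' = false := by
        cases f'
        · exact Or.inr rfl
        · simp at hy; left; omega
      rw [(s₁.2 hy').2.2, (s₂.2 hy').2.2]
  unfold bumpTo at h₁ h₂
  by_cases hd : x₁.1 = x₁.2
  · rw [if_pos hd] at h₁ h₂
    simp only [Prod.mk.injEq, Letter.ext_iff'] at *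
    obtain ⟨_, ⟨rfl, e1⟩, _⟩ := h₁
    obtain ⟨_, ⟨e3, e2⟩, _⟩ := h₂
    subst e3
    refine ⟨⟨rfl, by rw [hm₁ hd, hm₂ hd]⟩, ?_⟩
    cases h : occurs P x₁ m'.ceil
    · rw [h] at e1 e2
      simp at e1 e2
      rw [e1, e2]
    · rw [ho₁ hd h, ho₂ hd h]
  · have hlt : x₁.1 < x₁.2 := by
      have := (H.isShape x₁.1 x₁.2); have := hx₁.1; have := hx₁.2; omega
    obtain rfl := hff hlt
    rw [if_neg hd] at h₁ h₂
    refine ⟨?_, rfl⟩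
    split_ifs at h₁ h₂ <;>
      simp only [Prod.mk.injEq, Letter.ext_iff', Letter.unprime] at * <;>
      obtain ⟨_, ⟨g1, g2⟩, g3⟩ := h₁ <;> obtain ⟨_, ⟨i1, i2⟩, i3⟩ := h₂ <;>
      refine ⟨g1.trans i1.symm, ?_⟩ <;>
      first | exact g2.trans i2.symm | exact g3.trans i3.symm

theorem Ins.inj (h₁ : Ins P u P' b f) : ∀ {Q v}, Ins Q v P' b f → Valid P → Valid Q →
    P = Q ∧ u = v := by
  induction h₁ with
  | nil u =>
    intro Q v h₂ hP hQ
    generalize hP' : [(((0, 0) : ℕ × ℕ), u.unprime)] = P' at h₂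
    generalize hb' : ((0, 0) : ℕ × ℕ) = b' at h₂
    generalize hf' : u.primed = f' at h₂
    cases h₂ with
    | nil v =>
      refine ⟨rfl, ?_⟩
      simp [Letter.unprime] at hP'
      rw [Letter.ext_iff']
      exact ⟨hP', hf'⟩
    | place h => simp at hP'
    | step h h3 hs =>
      have := h3.length_eq
      simp only [List.cons.injEq] at hP'
      rw [← hP'.2] at this
      simp at this
  | @place x m u P h =>
    intro Q v h₂ hP hQ
    generalize hf' : false = f' at h₂
    generalize hb' : (0, rowLen ((x, m) :: P) 0) = b' at h₂
    generalize hP' : (b', u) :: (x, m) :: P = P' at h₂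
    cases h₂ with
    | nil v => simp at hP'
    | place h =>
      simp only [List.cons.injEq, Prod.mk.injEq, true_and] at hP'
      obtain ⟨⟨_, rfl⟩, ⟨rfl, rfl⟩, rfl⟩ := hP'
      exact ⟨rfl, rfl⟩
    | step h h3 hs =>
      exfalso
      obtain ⟨i1, i2, i3⟩ := h3.built hQ.1.1
      simp only [List.cons.injEq, Prod.mk.injEq] at hP'
      obtain ⟨⟨rfl, rfl⟩, rfl⟩ := hP'
      rcases hs with ⟨j1, rfl, rfl, rfl, rfl⟩ | ⟨rfl, hB, -⟩
      · exact j1 rfl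
      · have := (bumpTo_source i3 hB (by
          have := IsShape.removable_plus (i1); rw [← i2.1, ← i2.2] at this; exact this)).2
        have := (this (Or.inr hf'.symm)).1
        rw [← hb'] at this
        simp at this
  | @step x y b b' m m' u f f' P P₁ h h3 hs ih =>
    intro Q v h₂ hP hQ
    obtain ⟨i1, i2, i3⟩ := h3.built hP.1.1
    have hrem : Removable P₁ b := by
      have := IsShape.removable_plus i1; rw [← i2.1, ← i2.2] at this; exact this
    generalize hP' : (y, m') :: P₁ = P' at h₂
    cases h₂ with
    | nil v =>
      have := h3.length_eq
      simp only [List.cons.injEq] at hP'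
      rw [hP'.2] at this
      simp at this
    | place h =>
      exfalso
      simp only [List.cons.injEq, Prod.mk.injEq] at hP'
      obtain ⟨⟨rfl, rfl⟩, rfl⟩ := hP'
      rcases hs with ⟨j1, rfl, rfl, rfl, rfl⟩ | ⟨rfl, hB, -⟩
      · exact j1 rfl
      · have := ((bumpTo_source i3 hB hrem).2 (Or.inr rfl)).1
        simp at this
    | @step x₂ y₂ b₂ b₂' m₂ m₂' u₂ f₂ f₂' Q P₂ h' h4 hs' =>
      obtain ⟨k1, k2, k3⟩ := h4.built hQ.1.1
      have hrem' : Removable P₂ b₂ := by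
        have := IsShape.removable_plus k1; rw [← k2.1, ← k2.2] at this; exact this
      simp only [List.cons.injEq, Prod.mk.injEq] at hP'
      obtain ⟨⟨rfl, rfl⟩, rfl⟩ := hP'
      suffices hk : x = x₂ ∧ m = m₂ ∧ b = b₂ ∧ f = f₂ by
        obtain ⟨rfl, rfl, rfl, rfl⟩ := hk
        obtain ⟨rfl, rfl⟩ := ih h4 hP.tail hQ.tail
        exact ⟨rfl, rfl⟩
      have g1 := hP.2.1 _ List.mem_cons_self
      have g2 := hQ.2.1 _ List.mem_cons_self
      rcases hs with ⟨j1, rfl, rfl, rfl, rfl⟩ | ⟨rfl, hB, rfl⟩ <;>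
        rcases hs' with ⟨j1', rfl, rfl, hb, hf⟩ | ⟨rfl, hB', hb⟩
      · exact ⟨rfl, rfl, hb, hf⟩
      · exact absurd hb j1
      · exact absurd hb.symm j1'
      · obtain ⟨e1, e2, e3⟩ := bumpTo_inj i3 hB hB' hrem hrem' g1 g2
          (fun hd ho => h3.flag_of_occurs hP.1.1 hP.tail.2.1 hP.2.2.tail_lt h hd (g1 hd) ho)
          (fun hd ho => h4.flag_of_occurs hQ.1.1 hQ.tail.2.1 hQ.2.2.tail_lt h' hd (g2 hd) ho)
        exact ⟨e1, e2, e1, e3⟩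

end BoxChain

/-- The rows of a shifted tableau, with empty rows past the end. -/
abbrev RowFun := ℕ → List Letter

namespace RowFun

variable {ρ ρ₁ ρ₂ : RowFun} {x y b : ℕ × ℕ} {u v m e : Letter} {r c k n : ℕ} {f g : Bool}

/-- Append a letter at the end of the row of the box `x`. -/
def ext (ρ : RowFun) (x : ℕ × ℕ) (m : Letter) : RowFun :=
  Function.update ρ x.1 (ρ x.1 ++ [m])

def setAt (ρ : RowFun) (r k : ℕ) (u : Letter) : RowFun := Function.update ρ r ((ρ r).set k u)

/-- The box `x` may be added to the shifted diagram of `ρ`. -/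
def CanAdd (ρ : RowFun) (x : ℕ × ℕ) : Prop :=
  x.2 = x.1 + (ρ x.1).length ∧ (∀ r < x.1, x.2 < r + (ρ r).length) ∧
    ∀ r, x.1 < r → r ≤ x.2 → r + (ρ r).length ≤ x.2

theorem length_setAt (ρ : RowFun) (r k : ℕ) (u : Letter) (i : ℕ) :
    (setAt ρ r k u i).length = (ρ i).length := by
  unfold setAt
  by_cases h : i = r
  · subst h; simp
  · simp [h]

theorem CanAdd.setAt (h : CanAdd ρ x) : CanAdd (setAt ρ r k u) x := by
  simpa only [CanAdd, length_setAt] using h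

theorem ext_of_ne (h : r ≠ x.1) : ext ρ x m r = ρ r := by simp [ext, h]

theorem ext_self : ext ρ x m x.1 = ρ x.1 ++ [m] := by simp [ext]

theorem setAt_ext (h : k < (ρ r).length) :
    setAt (ext ρ x m) r k u = ext (setAt ρ r k u) x m := by
  funext i
  unfold setAt ext
  by_cases h1 : r = x.1
  · subst h1
    by_cases h2 : i = x.1
    · subst h2; simp [List.set_append_left _ _ h]
    · simp [h2]
  · by_cases h2 : i = x.1
    · subst h2; simp [Ne.symm h1]
    · by_cases h3 : i = r
      · subst h3; simp [h2]
      · simp [h2, h3]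

theorem setAt_ext_self : setAt (ext ρ x m) x.1 (ρ x.1).length u = ext ρ x u := by
  funext i
  unfold setAt ext
  by_cases h2 : i = x.1
  · subst h2; simp
  · simp [h2]

theorem ext_comm (h : b.1 ≠ x.1) : ext (ext ρ b u) x m = ext (ext ρ x m) b u := by
  funext i
  unfold ext
  by_cases h2 : i = x.1
  · subst h2; simp [Ne.symm h]
  · by_cases h3 : i = b.1
    · subst h3; simp [h]
    · simp [h2, h3]

theorem getElem?_ext :
    (ext ρ x m r)[k]? = some v ↔
      (ρ r)[k]? = some v ∨ (r = x.1 ∧ k = (ρ x.1).length ∧ v = m) := by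
  by_cases h : r = x.1
  · subst h
    rw [ext_self, List.getElem?_append]
    split_ifs with h1
    · constructor
      · exact Or.inl
      · rintro (h2 | ⟨_, h2, _⟩)
        · exact h2
        · omega
    · rw [List.getElem?_eq_none (by omega : (ρ x.1).length ≤ k)]
      by_cases h2 : k = (ρ x.1).length
      · subst h2; simp [eq_comm]
      · rw [List.getElem?_eq_none (by simp; omega)]
        simp [h2]
  · simp [ext_of_ne h, h]

theorem CanAdd.row_ne (hx : CanAdd ρ x) (hb : CanAdd ρ b) (h : b ≠ x) : b.1 ≠ x.1 := by
  intro h1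
  apply h
  have h2 := hx.1
  have h3 := hb.1
  rw [h1] at h3
  exact Prod.ext h1 (by omega)

theorem CanAdd.ext (hx : CanAdd ρ x) (hb : CanAdd ρ b) (h : b ≠ x) :
    CanAdd (ext ρ x m) b := by
  have h0 := hx.row_ne hb h
  obtain ⟨h1, h2, h3⟩ := hx
  obtain ⟨h4, h5, h6⟩ := hb
  refine ⟨by rw [ext_of_ne h0]; exact h4, fun r hr => ?_, fun r hr hr' => ?_⟩
  · by_cases hr2 : r = x.1
    · subst hr2; rw [ext_self]; have := h5 _ hr; simp; omega
    · rw [ext_of_ne hr2]; exact h5 r hr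
  · by_cases hr2 : r = x.1
    · subst hr2
      have := h6 _ hr hr'
      have := h2 _ hr
      rw [ext_self]
      simp
      omega
    · rw [ext_of_ne hr2]; exact h6 r hr hr'

/-- A run of the column stage inserting `u` in column `c`, adding the box `b` after `n` steps. -/
inductive ColRun : ℕ → RowFun → ℕ → Letter → RowFun → ℕ × ℕ → Prop
  | halt {ρ : RowFun} {r c : ℕ} {u : Letter} (hx : CanAdd ρ (r, c)) (hr : r < c)
      (hn : ∀ i < r, ∀ v, (ρ i)[c - i]? = some v → swBump false u v = false) :
      ColRun 1 ρ c u (ext ρ (r, c) u) (r, c)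
  | bump {n : ℕ} {ρ ρ₁ : RowFun} {r c : ℕ} {u v : Letter} {b : ℕ × ℕ} (hr : r < c)
      (hv : (ρ r)[c - r]? = some v) (hb : swBump false u v = true)
      (hn : ∀ i < r, ∀ v, (ρ i)[c - i]? = some v → swBump false u v = false)
      (h : ColRun n (setAt ρ r (c - r) u) (c + 1) v ρ₁ b) : ColRun (n + 1) ρ c u ρ₁ b

/-- A run of the row stage inserting `u` in row `r`, adding the box `b` after `n` steps. -/
inductive RowRun : ℕ → RowFun → ℕ → Letter → RowFun → ℕ × ℕ → Bool → Prop
  | halt {ρ : RowFun} {r : ℕ} {u : Letter} (hx : CanAdd ρ (r, r + (ρ r).length))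
      (hn : ∀ (i : ℕ) (v : Letter), (ρ r)[i]? = some v → swBump true u v = false)
      (hp : ρ r = [] → u.primed = false) :
      RowRun 1 ρ r u (ext ρ (r, r + (ρ r).length) u) (r, r + (ρ r).length) false
  | haltDiag {ρ : RowFun} {r : ℕ} {u : Letter} (hx : CanAdd ρ (r, r)) (h0 : ρ r = [])
      (hp : u.primed = true) : RowRun 1 ρ r u (ext ρ (r, r) u.unprime) (r, r) true
  | bump {n : ℕ} {ρ ρ₁ : RowFun} {r k : ℕ} {u v : Letter} {b : ℕ × ℕ} {f : Bool} (hk : k ≠ 0)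
      (hv : (ρ r)[k]? = some v) (hb : swBump true u v = true)
      (hn : ∀ i < k, ∀ v, (ρ r)[i]? = some v → swBump true u v = false)
      (h : RowRun n (setAt ρ r k u) (r + 1) v ρ₁ b f) : RowRun (n + 1) ρ r u ρ₁ b f
  | diag {n : ℕ} {ρ ρ₁ : RowFun} {r : ℕ} {u v : Letter} {b : ℕ × ℕ}
      (hv : (ρ r)[0]? = some v) (hb : swBump true u v = true) (hp : v.primed = false)
      (h : ColRun n (setAt ρ r 0 u.unprime) (r + 1)
        ⟨v.ceil, u.primed && !decide (u.ceil = v.ceil)⟩ ρ₁ b) : RowRun (n + 1) ρ r u ρ₁ b true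

theorem ColRun.lt (h : ColRun n ρ c u ρ₁ b) : b.1 < b.2 := by
  induction h with
  | halt _ hr _ => exact hr
  | bump _ _ _ _ _ ih => exact ih

theorem not_bump_ext (hx : CanAdd ρ x) (hr : r < c) (hv : c < r + (ρ r).length)
    (hn : ∀ i < r, ∀ v, (ρ i)[c - i]? = some v → swBump false u v = false) :
    ∀ i < r, ∀ v, (ext ρ x m i)[c - i]? = some v → swBump false u v = false := by
  intro i hi w hw
  rcases getElem?_ext.1 hw with hw | ⟨rfl, h2, rfl⟩
  · exact hn i hi w hw
  · have h3 := hx.1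
    have h4 : c = x.2 := by omega
    subst h4
    have := hx.2.2 r hi hr.le
    omega

theorem lt_of_getElem? {α : Type*} {l : List α} {v : α} (h : l[k]? = some v) : k < l.length :=
  (List.getElem?_eq_some_iff.1 h).1

theorem ColRun.ext_of_ne (h : ColRun n ρ c u ρ₁ b) (hx : CanAdd ρ x) (hb : b ≠ x) :
    ColRun n (ext ρ x m) c u (ext ρ₁ x m) b := by
  induction h with
  | @halt ρ r c u hy hr hn =>
    have h1 := hx.row_ne hy hb
    rw [ext_comm h1]
    refine ColRun.halt (hx.ext hy hb) hr ?_
    intro i hi w hw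
    rcases getElem?_ext.1 hw with hw | ⟨rfl, h2, rfl⟩
    · exact hn i hi w hw
    · have := hy.2.1 _ hi
      have h4 := hx.1
      simp only at this
      omega
  | bump hr hv hb' hn h ih =>
    have h1 := lt_of_getElem? hv
    refine ColRun.bump hr (getElem?_ext.2 (Or.inl hv)) hb' (not_bump_ext hx hr (by omega) hn) ?_
    rw [setAt_ext h1]
    exact ih hx.setAt hb

theorem RowRun.ext_of_ne (h : RowRun n ρ r u ρ₁ b f) (hx : CanAdd ρ x) (hb : b ≠ x) :
    RowRun n (ext ρ x m) r u (ext ρ₁ x m) b f := by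
  induction h with
  | @halt ρ r u hy hn hp =>
    have h1 := hx.row_ne hy hb
    have h2 : RowFun.ext ρ x m r = ρ r := RowFun.ext_of_ne h1
    have h3 := hx.ext (m := m) hy hb
    rw [ext_comm h1]
    rw [← h2] at h3 hn hp
    have := RowRun.halt h3 hn hp
    rwa [h2] at this
  | haltDiag hy h0 hp =>
    have h1 := hx.row_ne hy hb
    rw [ext_comm h1]
    refine RowRun.haltDiag (hx.ext hy hb) ?_ hp
    rw [RowFun.ext_of_ne h1]; exact h0
  | bump hk hv hb' hn h ih =>
    have h1 := lt_of_getElem? hv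
    refine RowRun.bump hk (getElem?_ext.2 (Or.inl hv)) hb' ?_ ?_
    · intro i hi w hw
      rcases getElem?_ext.1 hw with hw | ⟨rfl, h2, rfl⟩
      · exact hn i hi w hw
      · omega
    · rw [setAt_ext h1]
      exact ih hx.setAt hb
  | diag hv hb' hp h =>
    refine RowRun.diag (getElem?_ext.2 (Or.inl hv)) hb' hp ?_
    rw [setAt_ext (lt_of_getElem? hv)]
    exact h.ext_of_ne hx.setAt hb

theorem ColRun.ext_self (h : ColRun n ρ c u ρ₁ x) (hx : CanAdd ρ x)
    (he : (ρ₁ x.1)[x.2 - x.1]? = some e) (hm : e.Tri m)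
    (hk : ColRun k ρ₁ (x.2 + 1) m ρ₂ y) : ColRun (k + n) (ext ρ x m) c u ρ₂ y := by
  induction h with
  | @halt ρ r c u hy hr hn =>
    have h1 := hy.1
    simp only at h1 he
    have h2 : c - r = (ρ r).length := by omega
    rw [h2, RowFun.ext_self] at he
    simp at he
    subst he
    refine ColRun.bump hr (getElem?_ext.2 (Or.inr ⟨rfl, h2, rfl⟩))
      ((Letter.swBump_false _ _).2 hm) ?_ ?_
    · intro i hi w hw
      rw [RowFun.ext_of_ne (by simp only; omega)] at hw
      exact hn i hi w hw
    · rw [h2, setAt_ext_self (x := (r, c))]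
      exact hk
  | bump hr hv hb' hn h ih =>
    have h1 := lt_of_getElem? hv
    refine ColRun.bump hr (getElem?_ext.2 (Or.inl hv)) hb' (not_bump_ext hx hr (by omega) hn) ?_
    rw [setAt_ext h1]
    exact ih hx.setAt he hk

/-- The continuation of a run after `m` is displaced from the box `x`, now containing `e`. -/
def Continues (n : ℕ) (ρ : RowFun) (x : ℕ × ℕ) (e m : Letter) (f : Bool) (ρ' : RowFun)
    (y : ℕ × ℕ) (g : Bool) : Prop :=
  if x.1 = x.2 then
    g = true ∧ ColRun n ρ (x.2 + 1) ⟨m.ceil, f && !decide (e.ceil = m.ceil)⟩ ρ' y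
  else if f then g = true ∧ ColRun n ρ (x.2 + 1) m ρ' y
  else RowRun n ρ (x.1 + 1) m ρ' y g

theorem RowRun.ext_self (h : RowRun n ρ r u ρ₁ x f) (hx : CanAdd ρ x)
    (he : (ρ₁ x.1)[x.2 - x.1]? = some e) (hm : BoxChain.Displaces x f e m)
    (hd : x.1 = x.2 → m.primed = false)
    (hk : Continues k ρ₁ x e m f ρ₂ y g) : RowRun (k + n) (ext ρ x m) r u ρ₂ y g := by
  induction h with
  | @halt ρ r u hy hn hp =>
    have h2 : (r + (ρ r).length) - r = (ρ r).length := by omega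
    simp only [h2, RowFun.ext, Function.update_self] at he
    simp at he
    subst he
    by_cases h0 : ρ r = []
    · have hu := hp h0
      simp only [h0, List.length_nil, add_zero] at hm hd hk ⊢
      simp only [BoxChain.Displaces, if_true, Continues] at hm hk hd
      simp at hm
      obtain ⟨rfl, hk⟩ := hk
      refine RowRun.diag (getElem?_ext.2 (Or.inr ⟨rfl, by simp [h0], rfl⟩)) ?_ (hd trivial) ?_
      · rw [Letter.swBump_true, Letter.Tri]; omega
      · have := setAt_ext_self (ρ := ρ) (x := (r, r)) (m := m) (u := u.unprime)
        simp only [h0, List.length_nil] at this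
        rw [this]
        have hu' : u.unprime = u := by rw [Letter.ext_iff']; exact ⟨rfl, hu.symm⟩
        rw [hu', hu]
        simpa using hk
    · have h3 : (ρ r).length ≠ 0 := by simpa using h0
      rw [BoxChain.Displaces, if_neg (by simp only; omega), if_neg (by simp)] at hm
      rw [Continues, if_neg (by simp only; omega), if_neg (by simp)] at hk
      refine RowRun.bump h3 (getElem?_ext.2 (Or.inr ⟨rfl, rfl, rfl⟩))
        ((Letter.swBump_true _ _).2 hm) ?_ ?_
      · intro i hi w hw
        rcases getElem?_ext.1 hw with hw | ⟨_, h2, _⟩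
        · exact hn i w hw
        · simp only at h2; omega
      · rw [setAt_ext_self (x := (r, r + (ρ r).length))]
        exact hk
  | @haltDiag ρ r u hy h0 hp =>
    simp only [RowFun.ext, Function.update_self, h0] at he
    simp at he
    subst he
    simp only [BoxChain.Displaces, if_true, Continues, Letter.unprime] at hm hk hd
    obtain ⟨rfl, hk⟩ := hk
    refine RowRun.diag (getElem?_ext.2 (Or.inr ⟨rfl, by simp [h0], rfl⟩)) ?_ (hd trivial) ?_
    · rw [Letter.swBump_true, Letter.Tri, hp]; simp; omega
    · have := setAt_ext_self (ρ := ρ) (x := (r, r)) (m := m) (u := u.unprime)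
      simp only [h0, List.length_nil] at this
      rw [this, hp]
      exact hk
  | bump hk' hv hb' hn h ih =>
    have h1 := lt_of_getElem? hv
    refine RowRun.bump hk' (getElem?_ext.2 (Or.inl hv)) hb' ?_ ?_
    · intro i hi w hw
      rcases getElem?_ext.1 hw with hw | ⟨rfl, h2, rfl⟩
      · exact hn i hi w hw
      · omega
    · rw [setAt_ext h1]
      exact ih hx.setAt he hm hd hk
  | diag hv hb' hp h =>
    have hlt := h.lt
    rw [BoxChain.Displaces, if_neg (by omega), if_pos rfl] at hm
    rw [Continues, if_neg (by omega), if_pos rfl] at hk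
    obtain ⟨rfl, hk⟩ := hk
    refine RowRun.diag (getElem?_ext.2 (Or.inl hv)) hb' hp ?_
    rw [setAt_ext (lt_of_getElem? hv)]
    exact h.ext_self hx.setAt he hm hk

end RowFun

namespace BoxChain

open RowFun

variable {P P₁ P' Q : BoxChain} {m m' u v e : Letter} {x y b b' : ℕ × ℕ} {f f' : Bool}
  {r c k : ℕ}

/-- The rows of the tableau of a chain. -/
def rows : BoxChain → RowFun
  | [] => fun _ => []
  | (x, m) :: P => ext (rows P) x m

theorem rows_cons : rows ((x, m) :: P) = ext (rows P) x m := rfl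

theorem length_rows (P : BoxChain) (r : ℕ) : (rows P r).length = rowLen P r := by
  induction P with
  | nil => rfl
  | cons p P ih =>
    obtain ⟨x, m⟩ := p
    rw [rows_cons, rowLen_cons, plusRow]
    by_cases h : r = x.1
    · subst h; rw [RowFun.ext_self]; simp [ih]
    · rw [RowFun.ext_of_ne h, ih, if_neg (Ne.symm h)]; rfl

theorem Addable.canAdd (h : P.Addable x) (H : P.Built) : CanAdd (rows P) x := by
  have hs := fun r => H.isShape r x.2
  obtain ⟨h1, h2⟩ := h
  simp only [h2] at hs
  simp only [CanAdd, length_rows]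
  refine ⟨h1, fun r hr => ((hs r).1 hr).2, fun r hr hr' => ?_⟩
  have := hs r
  omega

theorem Built.getElem?_rows (H : P.Built) : (rows P r)[k]? = some v ↔ ((r, r + k), v) ∈ P := by
  induction P with
  | nil => simp [rows]
  | cons p P ih =>
    obtain ⟨x, m⟩ := p
    rw [rows_cons, getElem?_ext, ih H.1, List.mem_cons, length_rows, Prod.mk.injEq]
    have h1 := H.2.1
    simp only at h1
    have : (r = x.1 ∧ k = rowLen P x.1 ∧ v = m) ↔ ((r, r + k) = x ∧ v = m) := by
      rw [Prod.ext_iff]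
      simp only
      constructor
      · rintro ⟨rfl, rfl, rfl⟩; exact ⟨⟨rfl, h1.symm⟩, rfl⟩
      · rintro ⟨⟨rfl, h2⟩, rfl⟩; exact ⟨rfl, by omega, rfl⟩
    rw [this]
    tauto

/-- Placing the displaced letter at the end of its target row or column. -/
theorem continues_of_bumpTo (hV : Valid ((y, m') :: P₁)) (hB : bumpTo P₁ x m f = (y, m', f'))
    (hr : P₁.Removable x) (hle : x.1 ≤ x.2) (he : (x, e) ∈ P₁) :
    Continues 1 (rows P₁) x e m f (rows ((y, m') :: P₁)) y f' := by
  have H := hV.tail.1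
  have hy := Addable.canAdd (P := P₁) hV.1.2 H
  have hlt := hV.2.2.tail_lt
  have hcol : y.1 < y.2 → ∀ i < y.1, ∀ v, (rows P₁ i)[y.2 - i]? = some v →
      swBump false m' v = false := by
    intro h1 i hi v hv
    rw [H.getElem?_rows] at hv
    have h2 := hlt _ hv
    rw [Bool.eq_false_iff, ne_eq, Letter.swBump_false]
    unfold BoxLt BoxPrec at h2
    unfold Letter.Tri
    simp only at h2
    rcases h2 with h2 | ⟨h2, ⟨h3, _⟩ | ⟨h3, _, h4⟩⟩
    · omega
    · simp [h3]; omega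
    · omega
  have hocc : occurs P₁ x m.ceil = decide (e.ceil = m.ceil) := by
    rw [Bool.eq_iff_iff, occurs_iff, decide_eq_true_eq]
    constructor
    · rintro ⟨l, h1, h2⟩
      have hx : x = (x.1, x.1 + (x.2 - x.1)) := by ext <;> simp; omega
      rw [hx] at h1 he
      rw [← H.getElem?_rows] at h1 he
      rw [h1] at he
      simp only [Option.some.injEq] at he
      rw [← he, h2]
    · exact fun h => ⟨e, he, h⟩
  have hcolrun : y.2 = x.2 + 1 → y.1 < y.2 →
      ColRun 1 (rows P₁) (x.2 + 1) m' (rows ((y, m') :: P₁)) y := by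
    intro h1 h2
    obtain ⟨y1, y2⟩ := y
    simp only at h1 h2 hcol
    subst h1
    exact ColRun.halt hy h2 (hcol h2)
  have hrow : ∀ (i : ℕ) (v : Letter), (rows P₁ y.1)[i]? = some v → v.Tri m' := by
    intro i v hv
    have h5 : y.1 + i < y.2 := by have := hy.1; have := lt_of_getElem? hv; simp only at *; omega
    rw [H.getElem?_rows] at hv
    have h2 := hlt _ hv
    unfold BoxLt BoxPrec at h2
    unfold Letter.Tri
    simp only at h2
    rcases h2 with h2 | ⟨h2, ⟨_, h3 | h3⟩ | ⟨_, h3, _⟩⟩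
    · exact Or.inl h2
    · exact Or.inr ⟨h2, h3⟩
    · omega
    · exact Or.inr ⟨h2, h3⟩
  have hct := (H.isShape.col_target hr).2
  unfold bumpTo at hB
  unfold Continues
  split_ifs at hB with h1 h2 h3 <;> simp only [Prod.mk.injEq] at hB
  · rw [if_pos h1]
    obtain ⟨h4, h5, h6⟩ := hB
    refine ⟨h6.symm, ?_⟩
    rw [← hocc, h5]
    rw [← h4] at hcolrun ⊢
    exact hcolrun rfl (by simp only; omega)
  · rw [if_neg h1, if_pos h2]
    obtain ⟨h4, rfl, h6⟩ := hB
    refine ⟨h6.symm, ?_⟩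
    rw [← h4] at hcolrun ⊢
    exact hcolrun rfl (by simp only; omega)
  · rw [if_neg h1, if_neg h2]
    obtain ⟨rfl, rfl, rfl⟩ := hB
    simp only at hy
    have h0 : rows P₁ (x.1 + 1) = [] := by
      rw [← List.length_eq_zero_iff, length_rows, h3]
    cases hp : m.primed with
    | true => exact RowRun.haltDiag hy h0 hp
    | false =>
      have hu : m.unprime = m := by rw [Letter.ext_iff']; exact ⟨rfl, hp.symm⟩
      have := RowRun.halt (ρ := rows P₁) (r := x.1 + 1) (u := m)
      simp only [h0, List.length_nil, add_zero] at this
      rw [hu]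
      exact this hy (by simp) (fun _ => hp)
  · rw [if_neg h1, if_neg h2]
    obtain ⟨rfl, rfl, rfl⟩ := hB
    have := RowRun.halt (ρ := rows P₁) (r := x.1 + 1) (u := m)
    rw [length_rows] at this
    refine this hy ?_ ?_
    · intro i v hv
      rw [Bool.eq_false_iff, ne_eq, Letter.swBump_true, not_not]
      exact hrow i v hv
    · intro h
      rw [← List.length_eq_zero_iff, length_rows] at h
      exact absurd h h3

theorem Ins.run (h : Ins P u P' b f) (hV : P.Valid) :
    ∃ n ≤ P.length + 1, RowRun n (rows P) 0 u (rows P') b f := by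
  induction h with
  | nil u =>
    refine ⟨1, by simp, ?_⟩
    have h0 : CanAdd (rows []) (0, 0) := ⟨rfl, by simp, by simp [rows]⟩
    cases hp : u.primed with
    | true => exact RowRun.haltDiag h0 rfl hp
    | false =>
      have hu : u.unprime = u := by rw [Letter.ext_iff']; exact ⟨rfl, hp.symm⟩
      rw [hu]
      exact RowRun.halt (r := 0) (u := u) h0 (by simp [rows]) (fun _ => hp)
  | @place x m u P h =>
    refine ⟨1, by simp, ?_⟩
    have h0 := (hV.1.addable_row_zero).canAdd hV.1
    have h1 := hV.1.rowLen_zero_pos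
    rw [rows_cons]
    rw [← length_rows] at h0 h1 ⊢
    have := RowRun.halt (ρ := rows ((x, m) :: P)) (r := 0) (u := u)
    rw [zero_add] at this
    refine this h0 ?_ ?_
    · intro i v hv
      rw [hV.1.getElem?_rows] at hv
      rw [Bool.eq_false_iff, ne_eq, Letter.swBump_true, not_not]
      rcases List.mem_cons.1 hv with hv | hv
      · simp only [Prod.mk.injEq] at hv; rw [hv.2]; exact h
      · have h2 := hV.2.2.tail_lt _ hv
        unfold Letter.Tri at *
        rcases h2 with h2 | ⟨h2, _⟩
        · simp only at h2; omega
        · simp only at h2; rw [h2]; exact h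
    · intro h2; rw [h2] at h1; simp at h1
  | @step x y b b' m m' u f f' P P₁ h hP hs ih =>
    obtain ⟨n, hn, hrun⟩ := ih hV.tail
    have hB := hP.built hV.1.1
    have hx := hV.1.2.canAdd hV.1.1
    have hV' := (Ins.step h hP hs).valid hV
    have hN := hV.2.1 _ List.mem_cons_self
    rcases hs with ⟨h1, rfl, rfl, rfl, rfl⟩ | ⟨rfl, h1, rfl⟩
    · exact ⟨n, by simp; omega, hrun.ext_of_ne hx h1⟩
    · refine ⟨1 + n, by simp; omega, ?_⟩
      have hle := hV.1.2.le
      have hr := IsShape.removable_plus hB.1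
      rw [← hB.2.1.1, ← hB.2.1.2] at hr
      have hlen : b.2 - b.1 < (rows P₁ b.1).length := by
        rw [length_rows]; have := hr.1; simp only at hle; omega
      have he := List.getElem?_eq_getElem hlen
      have he' := hB.2.2.getElem?_rows.1 he
      have hbb : (b.1, b.1 + (b.2 - b.1)) = b := by
        ext
        · rfl
        · simp only at hle ⊢; omega
      rw [hbb] at he'
      exact hrun.ext_self hx he (hP.displaces hV.1.1 hV.tail.2.1 hV.2.2.tail_lt h hN he') hN
        (continues_of_bumpTo hV' h1 hr hle he')

end BoxChain

/-- The tableau `T` has the nonempty rows `ρ`. -/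
def Represents (T : STab) (ρ : RowFun) : Prop := (∀ r, T.getD r [] = ρ r) ∧ [] ∉ T

namespace Represents

open RowFun

variable {T T' : STab} {ρ ρ₁ : RowFun} {r c k n : ℕ} {u v : Letter} {b x : ℕ × ℕ} {f : Bool}

theorem lt_length_iff (h : Represents T ρ) : r < T.length ↔ ρ r ≠ [] := by
  rw [← h.1 r]
  constructor
  · intro hr h2
    rw [List.getD_eq_getElem _ _ hr] at h2
    exact h.2 (h2 ▸ List.getElem_mem hr)
  · intro hr
    by_contra h2
    exact hr (List.getD_eq_default _ _ (by omega))

theorem unique (h : Represents T ρ) (h' : Represents T' ρ) : T = T' := by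
  have hlt : ∀ r, r < T.length ↔ r < T'.length := fun r => h.lt_length_iff.trans h'.lt_length_iff.symm
  have hlen : T.length = T'.length := by
    have h1 := hlt T.length
    have h2 := hlt T'.length
    omega
  refine List.ext_getElem hlen fun r h1 h2 => ?_
  rw [← List.getD_eq_getElem _ [] h1, ← List.getD_eq_getElem _ [] h2, h.1, h'.1]

theorem nil : Represents [] (fun _ => []) := ⟨by simp, by simp⟩

theorem setRow (h : Represents T ρ) {row : List Letter} (hr : r ≤ T.length) (hrow : row ≠ []) :
    Represents (setRowG T r row) (Function.update ρ r row) := by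
  unfold setRowG
  split_ifs with h1
  · refine ⟨fun i => ?_, fun h2 => ?_⟩
    · by_cases h2 : i = r
      · subst h2
        simp [List.getD_eq_getElem?_getD, h1]
      · rw [Function.update_of_ne h2, ← h.1 i]
        simp [List.getD_eq_getElem?_getD, List.getElem?_set_ne (Ne.symm h2)]
    · rcases List.mem_or_eq_of_mem_set h2 with h2 | h2
      · exact h.2 h2
      · exact hrow h2.symm
  · have h2 : r = T.length := by omega
    subst h2
    refine ⟨fun i => ?_, fun h2 => ?_⟩
    · by_cases h2 : i = T.length
      · subst h2; simp
      · rw [Function.update_of_ne h2, ← h.1 i]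
        simp only [List.getD_eq_getElem?_getD, List.getElem?_append]
        split_ifs with h3
        · rfl
        · rw [List.getElem?_eq_none (by simp; omega), List.getElem?_eq_none (by omega)]
    · rcases List.mem_append.1 h2 with h2 | h2
      · exact h.2 h2
      · simp at h2; exact hrow h2

theorem setEntry (h : Represents T ρ) :
    Represents (setEntryG T r c u) (setAt ρ r (c - r) u) := by
  unfold setEntryG setAt
  rw [h.1]
  by_cases hr : r < T.length
  · have h2 := h.setRow (r := r) (row := (ρ r).set (c - r) u) hr.le ?_
    · simpa only [setRowG, if_pos hr] using h2
    · have := h.lt_length_iff.1 hr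
      simpa using this
  · have h2 : ρ r = [] := by
      by_contra h3
      exact hr (h.lt_length_iff.2 h3)
    rw [List.set_eq_of_length_le (by omega), h2, List.set_nil, ← h2, Function.update_eq_self]
    exact h

theorem append (h : Represents T ρ) (hx : CanAdd ρ x) :
    Represents (setRowG T x.1 (T.getD x.1 [] ++ [u])) (ext ρ x u) := by
  rw [h.1]
  refine h.setRow ?_ (by simp)
  by_contra h1
  have h3 := hx.2.1 T.length (by omega)
  have h4 := hx.1
  have h5 := h.lt_length_iff (r := T.length)
  simp only [lt_irrefl, ne_eq, false_iff, not_not] at h5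
  simp only [h5, List.length_nil] at h3
  omega

theorem entry?_eq (h : Represents T ρ) (hr : r ≤ c) : entry? T r c = (ρ r)[c - r]? := by
  unfold entry? entryG?
  rw [if_pos hr, ← h.1 r, List.getD_eq_getElem?_getD]
  cases T[r]? <;> simp

/-- The search of the column stage finds the first entry that is bumped. -/
theorem find?_col (h : Represents T ρ) (hr : r ≤ c) (hv : (ρ r)[c - r]? = some v)
    (hb : swBump false u v = true)
    (hn : ∀ i < r, ∀ v, (ρ i)[c - i]? = some v → swBump false u v = false) :
    ((List.range (c + 1)).filterMap (fun r => (entry? T r c).map (fun x => (r, x)))).find?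
      (fun p => swBump false u p.2) = some (r, v) := by
  rw [List.find?_filterMap]
  have : (List.range (c + 1)).find? (fun a => ((entry? T a c).map (fun x => (a, x))).any
      (fun p => swBump false u p.2)) = some r := by
    rw [List.find?_range_eq_some]
    refine ⟨?_, by simp; omega, fun i hi => ?_⟩
    · rw [h.entry?_eq hr, hv]; simpa using hb
    · rw [h.entry?_eq (by omega)]
      cases hw : (ρ i)[c - i]? with
      | none => simp
      | some w => simpa using hn i hi w hw
  rw [this]
  simp [h.entry?_eq hr, hv]

theorem find?_col_none (h : Represents T ρ) (hx : CanAdd ρ (r, c)) (hr : r ≤ c)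
    (hn : ∀ i < r, ∀ v, (ρ i)[c - i]? = some v → swBump false u v = false) :
    ((List.range (c + 1)).filterMap (fun r => (entry? T r c).map (fun x => (r, x)))).find?
      (fun p => swBump false u p.2) = none := by
  rw [List.find?_eq_none]
  rintro ⟨i, v⟩ hiv
  simp only [List.mem_filterMap, List.mem_range, Option.map_eq_some_iff, Prod.mk.injEq] at hiv
  obtain ⟨i, hi, v, hv, rfl, rfl⟩ := hiv
  rw [h.entry?_eq (by omega)] at hv
  have h1 := lt_of_getElem? hv
  have h2 : i < r := by
    by_contra h2
    have h3 := hx.1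
    have h4 := hx.2.2 i
    simp only at h3 h4
    rcases Nat.lt_or_ge r i with h5 | h5
    · have := h4 h5 (by omega); omega
    · have : i = r := by omega
      subst this; omega
  simp [hn i h2 v hv]

theorem length_col (h : Represents T ρ) (hx : CanAdd ρ (r, c)) (hr : r ≤ c) :
    ((List.range (c + 1)).filterMap (fun r => (entry? T r c).map (fun x => (r, x)))).length
      = r := by
  have hiff : ∀ i < c + 1, ((entry? T i c).map (fun x => (i, x))).isSome = decide (i < r) := by
    intro i hi
    rw [h.entry?_eq (by omega), Option.isSome_map, Bool.eq_iff_iff, decide_eq_true_eq,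
      Option.isSome_iff_ne_none, ne_eq, List.getElem?_eq_none_iff]
    have h3 := hx.1
    have h4 := hx.2.1 i
    have h5 := hx.2.2 i
    simp only at h3 h4 h5
    rcases lt_trichotomy i r with h6 | h6 | h6
    · have := h4 h6; omega
    · subst h6; omega
    · have := h5 h6 (by omega); omega
  rw [List.length_filterMap_eq_countP, List.countP_congr (q := fun i => decide (i < r))]
  · obtain ⟨d, rfl⟩ : ∃ d, c = r + d := ⟨c - r, by omega⟩
    clear hiff h hx hr
    rw [add_assoc, List.range_add, List.countP_append, List.countP_eq_length.2 (by simp),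
      List.countP_eq_zero.2 (by simp)]
    simp
  · intro i hi
    rw [hiff i (List.mem_range.1 hi)]

end Represents

namespace RowFun

variable {T T' : STab} {ρ ρ₁ : RowFun} {r c k n : ℕ} {u v : Letter} {b x : ℕ × ℕ} {f : Bool}

theorem ColRun.swColO (h : ColRun n ρ c u ρ₁ b) : ∀ {N T}, n ≤ N → Represents T ρ →
    ∃ T', swColO N T c u = (T', true) ∧ Represents T' ρ₁ := by
  induction h with
  | @halt ρ r c u hx hr hn =>
    intro N T hN hT
    obtain ⟨N, rfl⟩ : ∃ M, N = M + 1 := ⟨N - 1, by omega⟩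
    refine ⟨_, ?_, hT.append hx⟩
    rw [_root_.swColO, hT.find?_col_none hx hr.le hn]
    simp only [hT.length_col hx hr.le]
    rw [if_neg (by omega)]
  | @bump n ρ ρ₁ r c u v b hr hv hb hn h ih =>
    intro N T hN hT
    obtain ⟨N, rfl⟩ : ∃ M, N = M + 1 := ⟨N - 1, by omega⟩
    rw [_root_.swColO, hT.find?_col hr.le hv hb hn]
    simp only
    rw [if_neg (by omega)]
    exact ih (by omega) hT.setEntry

theorem RowRun.swRowO (h : RowRun n ρ r u ρ₁ b f) : ∀ {N T}, n ≤ N → Represents T ρ →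
    ∃ T', swRowO N T r u = (T', f) ∧ Represents T' ρ₁ := by
  induction h with
  | @halt ρ r u hx hn hp =>
    intro N T hN hT
    obtain ⟨N, rfl⟩ : ∃ M, N = M + 1 := ⟨N - 1, by omega⟩
    have h1 : (ρ r).findIdx? (fun v => swBump true u v) = none := by
      rw [List.findIdx?_eq_none_iff]
      intro v hv
      obtain ⟨i, hi⟩ := List.getElem?_of_mem hv
      exact hn i v hi
    refine ⟨_, ?_, hT.append hx⟩
    rw [_root_.swRowO]
    simp only [hT.1, h1]
    rw [if_neg]
    rintro ⟨h2, h3⟩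
    rw [hp (by simpa using h2)] at h3
    simp at h3
  | @haltDiag ρ r u hx h0 hp =>
    intro N T hN hT
    obtain ⟨N, rfl⟩ : ∃ M, N = M + 1 := ⟨N - 1, by omega⟩
    refine ⟨_, ?_, hT.append hx⟩
    rw [_root_.swRowO]
    simp only [hT.1, h0]
    simp [hp]
  | @bump n ρ ρ₁ r k u v b f hk hv hb hn h ih =>
    intro N T hN hT
    obtain ⟨N, rfl⟩ : ∃ M, N = M + 1 := ⟨N - 1, by omega⟩
    have hlt := lt_of_getElem? hv
    have h1 : (ρ r).findIdx? (fun v => swBump true u v) = some k := by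
      rw [List.findIdx?_eq_some_iff_getElem]
      refine ⟨hlt, ?_, ?_⟩
      · rw [(List.getElem?_eq_some_iff.1 hv).2]; exact hb
      · intro j hj
        rw [hn j hj _ (List.getElem?_eq_getElem _)]
        simp
    rw [_root_.swRowO]
    simp only [hT.1, h1]
    rw [if_neg hk, List.getD_eq_getElem?_getD, hv]
    refine ih (by omega) (hT.setRow (hT.lt_length_iff.2 ?_).le ?_)
    · intro h2; simp [h2] at hlt
    · intro h2; simp at h2; simp [h2] at hlt
  | @diag n ρ ρ₁ r u v b hv hb hp h =>
    intro N T hN hT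
    obtain ⟨N, rfl⟩ : ∃ M, N = M + 1 := ⟨N - 1, by omega⟩
    have hlt := lt_of_getElem? hv
    have h1 : (ρ r).findIdx? (fun v => swBump true u v) = some 0 := by
      rw [List.findIdx?_eq_some_iff_getElem]
      refine ⟨hlt, ?_, by simp⟩
      rw [(List.getElem?_eq_some_iff.1 hv).2]; exact hb
    rw [_root_.swRowO]
    simp only [hT.1, h1]
    rw [if_pos trivial, List.getD_eq_getElem?_getD, hv]
    simp only [Option.getD_some]
    have hvu : v.unprime = v := by rw [Letter.ext_iff']; exact ⟨rfl, hp.symm⟩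
    split_ifs with h2
    · have h3 : setAt ρ r 0 u.unprime = ρ := by
        have h4 : u.unprime = v := by rw [Letter.ext_iff']; exact ⟨h2, hp.symm⟩
        unfold setAt
        rw [h4, ← (List.getElem?_eq_some_iff.1 hv).2, List.set_getElem_self,
          Function.update_eq_self]
      rw [h3] at h
      have h5 : (⟨v.ceil, u.primed && !decide (u.ceil = v.ceil)⟩ : Letter) = v.unprime := by
        simp [h2, Letter.unprime]
      rw [h5] at h
      exact h.swColO (by omega) hT
    · have h3 : switchPrimes u v = (u.unprime, ⟨v.ceil, u.primed && !decide (u.ceil = v.ceil)⟩) := by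
        unfold switchPrimes
        cases hu : u.primed <;> simp [hp, h2, Letter.unprime, Letter.ext_iff', hu]
      rw [h3]
      refine h.swColO (by omega) (hT.setRow (hT.lt_length_iff.2 ?_).le ?_)
      · intro h2; simp [h2] at hlt
      · intro h2; simp at h2; simp [h2] at hlt

end RowFun

namespace BoxChain

open RowFun

variable {P P' Q Q' : BoxChain} {T : STab} {m u v : Letter} {x b : ℕ × ℕ} {f : Bool} {r c k : ℕ}

/-- The shifted tableau of a chain. -/
def toTab : BoxChain → STab
  | [] => []
  | (x, m) :: P => setRowG (toTab P) x.1 ((toTab P).getD x.1 [] ++ [m])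

theorem represents_toTab : ∀ {P : BoxChain}, P.Built → Represents (toTab P) (rows P)
  | [], _ => Represents.nil
  | (x, _) :: _, h => (represents_toTab h.1).append (Addable.canAdd (x := x) h.2 h.1)

theorem flatten_setRowG_append (T : STab) (r : ℕ) (m : Letter) :
    (setRowG T r (T.getD r [] ++ [m])).flatten.Perm (m :: T.flatten) := by
  unfold setRowG
  split_ifs with h
  · induction T generalizing r with
    | nil => simp at h
    | cons t T ih =>
      cases r with
      | zero => simp
      | succ r =>
        have h1 := ih r (by simpa using h)
        simp only [List.getD_cons_succ, List.set_cons_succ, List.flatten_cons]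
        exact (h1.append_left t).trans List.perm_middle
  · rw [List.getD_eq_default _ _ (by omega)]
    simp

theorem flatten_toTab : ∀ P : BoxChain, (toTab P).flatten.Perm (P.map (·.2))
  | [] => List.Perm.refl _
  | (_, _) :: P => (flatten_setRowG_append _ _ _).trans ((flatten_toTab P).cons _)

theorem Ins.swInsertO (h : Ins P u P' b f) (H : P.Valid) :
    swInsertO (toTab P) u = (toTab P', f) := by
  obtain ⟨n, hn, hr⟩ := h.run H
  have hl : (toTab P).flatten.length = P.length := by
    rw [(flatten_toTab P).length_eq, List.length_map]
  obtain ⟨T', h1, h2⟩ := hr.swRowO (N := (toTab P).flatten.length + (toTab P).length + 2)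
    (by omega) (represents_toTab H.1)
  unfold _root_.swInsertO
  rw [h1, h2.unique (represents_toTab (h.valid H).1)]

theorem length_getD_toTab (H : P.Built) (r : ℕ) : ((toTab P).getD r []).length = rowLen P r := by
  rw [(represents_toTab H).1, length_rows]

theorem lt_length_toTab (H : P.Built) : r < (toTab P).length ↔ 0 < rowLen P r := by
  rw [(represents_toTab H).lt_length_iff, ← length_rows, List.length_pos_iff]

theorem addBox_toTab (hP : P.Built) (hP' : P'.Built) (hr : rowLen P' = plusRow (rowLen P) b) :
    addBox (toTab Q) (toTab P) (toTab P') m = toTab ((b, m) :: Q) := by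
  have h : (List.range (toTab P').length).find? (fun r =>
      decide (((toTab P).getD r []).length ≠ ((toTab P').getD r []).length)) = some b.1 := by
    rw [List.find?_range_eq_some]
    simp only [length_getD_toTab hP, length_getD_toTab hP', hr, plusRow]
    refine ⟨by simp, ?_, fun j hj => ?_⟩
    · rw [List.mem_range, lt_length_toTab hP', hr, plusRow]; simp
    · have : b.1 ≠ j := by omega
      simp [this]
  unfold addBox
  rw [h]
  rfl

theorem le_of_entry? {T : STab} (h : entry? T r c = some v) : r ≤ c := by
  unfold entry? entryG? at h
  by_contra h1
  simp [h1] at h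

theorem entry?_toTab (H : P.Built) : entry? (toTab P) r c = some v ↔ ((r, c), v) ∈ P := by
  by_cases hr : r ≤ c
  · rw [(represents_toTab H).entry?_eq hr, H.getElem?_rows, Nat.add_sub_cancel' hr]
  · constructor
    · exact fun h => absurd (le_of_entry? h) hr
    · exact fun h => absurd (H.mem_le h) hr

theorem Built.exists_mem (H : P.Built) (h : r < colLen P c) : ∃ v, ((r, c), v) ∈ P := by
  have h1 := (H.isShape r c).1 h
  have h2 : c - r < (rows P r).length := by rw [length_rows]; omega
  refine ⟨(rows P r)[c - r], ?_⟩
  have h3 := H.getElem?_rows.1 (List.getElem?_eq_getElem h2)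
  rwa [Nat.add_sub_cancel' h1.1] at h3

theorem Built.nodup : ∀ {P : BoxChain}, P.Built → P.Nodup
  | [], _ => List.nodup_nil
  | (_, _) :: _, h => List.nodup_cons.2 ⟨h.1.not_mem_addable h.2, Built.nodup h.1⟩

theorem Ordered.pairwise : ∀ {P : BoxChain}, P.Ordered → P.Pairwise (fun p q => BoxLt q p)
  | [], _ => List.Pairwise.nil
  | (_, _) :: _, h => List.pairwise_cons.2 ⟨h.1.forall_lt h.2, Ordered.pairwise h.1⟩

theorem _root_.BoxLt.irrefl (p : (ℕ × ℕ) × Letter) : ¬ BoxLt p p := by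
  unfold BoxLt BoxPrec
  cases p.2.primed <;> simp

theorem toTab_inj (hP : P.Built) (hQ : Q.Built) (hP' : P.Ordered) (hQ' : Q.Ordered)
    (h : toTab P = toTab Q) : P = Q := by
  have hp : P.Perm Q := by
    rw [List.perm_ext_iff_of_nodup hP.nodup hQ.nodup]
    rintro ⟨⟨r, c⟩, v⟩
    rw [← entry?_toTab hP, h, entry?_toTab hQ]
  exact hp.eq_of_pairwise (fun a b _ _ h1 h2 => absurd (h1.trans h2) (BoxLt.irrefl _))
    hP'.pairwise hQ'.pairwise

/-- Strictly increasing positions carry increasing letters. -/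
theorem Ordered.boxLt (h : P.Ordered) (H : P.Built) {p q : (ℕ × ℕ) × Letter} (hp : p ∈ P)
    (hq : q ∈ P) (h1 : p.1.1 ≤ q.1.1) (h2 : p.1.2 ≤ q.1.2) (hpq : p ≠ q) : BoxLt p q := by
  induction P with
  | nil => simp at hp
  | cons a P ih =>
    rcases List.mem_cons.1 hp with rfl | hp'
    · rcases List.mem_cons.1 hq with rfl | hq'
      · exact absurd rfl hpq
      · have := H.1.mem_addable hq' H.2
        omega
    · rcases List.mem_cons.1 hq with rfl | hq'
      · exact h.1.forall_lt h.2 _ hp'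
      · exact ih h.1 H.1 hp' hq'

theorem isSemistandard_toTab (H : P.Built) (h : P.Ordered) (hpos : ∀ p ∈ P, 0 < p.2.ceil) :
    IsSemistandard (toTab P) := by
  have hrow : ∀ (r c c' : ℕ) (x y : Letter), c < c' → ((r, c), x) ∈ P → ((r, c'), y) ∈ P →
      x ≤ y ∧ (x = y → x.primed = false) := by
    intro r c c' x y hc hx hy
    have h1 := h.boxLt H hx hy le_rfl (by simp; omega) (by simp; omega)
    rw [Letter.le_iff, Letter.ext_iff']
    unfold BoxLt BoxPrec at h1
    cases hxp : x.primed <;> cases hyp : y.primed <;> simp_all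
    omega
  have hcol : ∀ (r r' c : ℕ) (x y : Letter), r < r' → ((r, c), x) ∈ P → ((r', c), y) ∈ P →
      x ≤ y ∧ (x = y → x.primed = true) := by
    intro r r' c x y hc hx hy
    have h1 := h.boxLt H hx hy (by simp; omega) le_rfl (by simp; omega)
    rw [Letter.le_iff, Letter.ext_iff']
    unfold BoxLt BoxPrec at h1
    cases hxp : x.primed <;> cases hyp : y.primed <;> simp_all
    omega
  simp only [IsSemistandard, entry?_toTab H]
  refine ⟨fun x hx => ?_, fun r c x y hx hy => (hrow r c (c + 1) x y (by omega) hx hy).1,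
    fun r c x y hx hy => (hcol r (r + 1) c x y (by omega) hx hy).1,
    fun r c c' x hc hx hy => (hrow r c c' x x hc hx hy).2 rfl,
    fun r r' c x hc hx hy => (hcol r r' c x x hc hx hy).2 rfl⟩
  rw [(flatten_toTab P).mem_iff, List.mem_map] at hx
  obtain ⟨p, hp, rfl⟩ := hx
  exact hpos p hp

theorem noDiagPrimes_toTab (H : P.Built) : NoDiagPrimes (toTab P) ↔ P.NoDiag := by
  simp only [NoDiagPrimes, entry?_toTab H]
  constructor
  · rintro h ⟨⟨r, c⟩, v⟩ hp hd
    simp only at hd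
    subst hd
    exact h r v hp
  · exact fun h r x hx => h _ hx rfl

theorem isShifted_toTab (H : P.Built) : IsShifted (toTab P) := by
  have hT := represents_toTab H
  have hlen : ∀ (i : ℕ) (hi : i < (toTab P).length), (toTab P)[i].length = rowLen P i := by
    intro i hi
    rw [← length_getD_toTab H, List.getD_eq_getElem _ _ hi]
  refine ⟨?_, fun n hn => ?_⟩
  · unfold shapeOf
    refine List.isChain_iff_getElem.2 fun i hi => ?_
    simp only [List.length_map] at hi
    simp only [List.getElem_map]
    rw [hlen _ hi, hlen _ (by omega)]
    have h1 := (lt_length_toTab H).1 hi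
    have h2 := H.isShape (i + 1) (i + rowLen P (i + 1))
    have h3 := H.isShape i (i + rowLen P (i + 1))
    omega
  · obtain ⟨row, hrow, rfl⟩ := List.mem_map.1 hn
    exact List.length_pos_iff.2 fun h => hT.2 (h ▸ hrow)

theorem shapeOf_toTab_eq_iff (hP : P.Built) (hQ : Q.Built) :
    shapeOf (toTab P) = shapeOf (toTab Q) ↔ rowLen P = rowLen Q := by
  unfold shapeOf
  constructor
  · intro h
    funext r
    have h1 := congrArg (fun l => l.getD r (List.length ([] : List Letter))) h
    simp only [List.getD_map] at h1
    rwa [length_getD_toTab hP, length_getD_toTab hQ] at h1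
  · intro h
    have hlt : ∀ r, r < (toTab P).length ↔ r < (toTab Q).length := fun r => by
      rw [lt_length_toTab hP, lt_length_toTab hQ, h]
    have hlen : (toTab P).length = (toTab Q).length := by
      have h1 := hlt (toTab P).length
      have h2 := hlt (toTab Q).length
      omega
    refine List.ext_getElem (by simpa using hlen) fun r h1 h2 => ?_
    simp only [List.length_map] at h1 h2
    simp only [List.getElem_map]
    rw [← List.getD_eq_getElem _ [] h1, ← List.getD_eq_getElem _ [] h2, length_getD_toTab hP,
      length_getD_toTab hQ, h]

theorem Built.colLen_eq (hP : P.Built) (hQ : Q.Built) (h : rowLen P = rowLen Q) :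
    colLen P = colLen Q := by
  funext c
  have h1 := fun r => (hP.isShape r c).trans ((h ▸ hQ.isShape r c : _ ↔ _)).symm
  have h2 := h1 (colLen P c)
  have h3 := h1 (colLen Q c)
  omega

end BoxChain

/-- The cells of a semistandard filling of a shifted diagram, in no particular order. -/
structure IsFilling (S : Finset ((ℕ × ℕ) × Letter)) : Prop where
  le : ∀ p ∈ S, p.1.1 ≤ p.1.2
  inj : ∀ p ∈ S, ∀ q ∈ S, p.1 = q.1 → p = q
  down : ∀ p ∈ S, ∀ r c, r ≤ c → r ≤ p.1.1 → c ≤ p.1.2 → ∃ q ∈ S, q.1 = (r, c)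
  boxLt : ∀ p ∈ S, ∀ q ∈ S, p.1.1 ≤ q.1.1 → p.1.2 ≤ q.1.2 → p ≠ q → BoxLt p q

namespace IsFilling

variable {S : Finset ((ℕ × ℕ) × Letter)}

theorem total (h : IsFilling S) {p q : (ℕ × ℕ) × Letter} (hp : p ∈ S) (hq : q ∈ S)
    (hpq : p ≠ q) : BoxLt p q ∨ BoxLt q p := by
  have h1 := h.boxLt p hp q hq
  have h2 := h.boxLt q hq p hp
  rcases le_total p.1.1 q.1.1 with h3 | h3 <;> rcases le_total p.1.2 q.1.2 with h4 | h4
  · exact Or.inl (h1 h3 h4 hpq)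
  · by_cases h5 : p.1.1 = q.1.1
    · exact Or.inr (h2 h5.ge h4 hpq.symm)
    by_cases h6 : p.1.2 = q.1.2
    · exact Or.inl (h1 h3 h6.le hpq)
    unfold BoxLt BoxPrec
    cases p.2.primed <;> cases q.2.primed <;> simp <;> omega
  · by_cases h5 : p.1.1 = q.1.1
    · exact Or.inl (h1 h5.le h4 hpq)
    by_cases h6 : p.1.2 = q.1.2
    · exact Or.inr (h2 h3 h6.ge hpq.symm)
    unfold BoxLt BoxPrec
    cases p.2.primed <;> cases q.2.primed <;> simp <;> omega
  · exact Or.inr (h2 h3 h4 hpq.symm)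

theorem exists_max (h : IsFilling S) (hS : S.Nonempty) :
    ∃ p ∈ S, ∀ q ∈ S, q ≠ p → BoxLt q p := by
  have : ∀ T ⊆ S, T.Nonempty → ∃ p ∈ T, ∀ q ∈ T, q ≠ p → BoxLt q p := by
    intro T
    induction T using Finset.induction_on with
    | empty => simp
    | insert a T ha ih =>
      intro hT _
      rw [Finset.insert_subset_iff] at hT
      rcases T.eq_empty_or_nonempty with rfl | hne
      · exact ⟨a, by simp, by simp⟩
      · obtain ⟨p, hp, hp'⟩ := ih hT.2 hne
        have hpa : p ≠ a := fun h => ha (h ▸ hp)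
        rcases h.total (hT.2 hp) hT.1 hpa with h1 | h1
        · refine ⟨a, by simp, fun q hq hqa => ?_⟩
          have hq' := Finset.mem_of_mem_insert_of_ne hq hqa
          by_cases hqp : q = p
          · exact hqp ▸ h1
          · exact (hp' q hq' hqp).trans h1
        · refine ⟨p, by simp [hp], fun q hq hqp => ?_⟩
          rcases Finset.mem_insert.1 hq with rfl | hq'
          · exact h1
          · exact hp' q hq' hqp
  exact this S subset_rfl hS

theorem erase (h : IsFilling S) {p : (ℕ × ℕ) × Letter} (hp : p ∈ S)
    (hmax : ∀ q ∈ S, q ≠ p → BoxLt q p) : IsFilling (S.erase p) where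
  le q hq := h.le q (Finset.mem_of_mem_erase hq)
  inj q hq q' hq' := h.inj q (Finset.mem_of_mem_erase hq) q' (Finset.mem_of_mem_erase hq')
  boxLt q hq q' hq' := h.boxLt q (Finset.mem_of_mem_erase hq) q' (Finset.mem_of_mem_erase hq')
  down q hq r c hrc hr hc := by
    have hq' := Finset.mem_of_mem_erase hq
    obtain ⟨t, ht, htrc⟩ := h.down q hq' r c hrc hr hc
    refine ⟨t, Finset.mem_erase.2 ⟨?_, ht⟩, htrc⟩
    rintro rfl
    have h1 := h.boxLt t ht q hq' (by rw [htrc]; exact hr) (by rw [htrc]; exact hc)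
      (Finset.ne_of_mem_erase hq).symm
    exact BoxLt.irrefl _ (h1.trans (hmax q hq' (Finset.ne_of_mem_erase hq)))

theorem exists_chain (h : IsFilling S) :
    ∃ P : BoxChain, P.Built ∧ P.Ordered ∧ ∀ p, p ∈ P ↔ p ∈ S := by
  induction hn : S.card generalizing S with
  | zero =>
    rw [Finset.card_eq_zero] at hn
    subst hn
    exact ⟨[], trivial, trivial, by simp⟩
  | succ n ih =>
    obtain ⟨p, hp, hmax⟩ := h.exists_max (Finset.card_pos.1 (by omega))
    obtain ⟨P, hB, hO, hm⟩ := ih (h.erase hp hmax) (by rw [Finset.card_erase_of_mem hp, hn]; rfl)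
    simp only [Finset.mem_erase] at hm
    have hocc : ∀ r c, r < colLen P c ↔ ∃ q ∈ S, q ≠ p ∧ q.1 = (r, c) := by
      intro r c
      constructor
      · intro hr
        obtain ⟨v, hv⟩ := hB.exists_mem hr
        exact ⟨_, ((hm _).1 hv).2, ((hm _).1 hv).1, rfl⟩
      · rintro ⟨q, hq, hqp, hqrc⟩
        have := hB.lt_colLen q ((hm q).2 ⟨hqp, hq⟩)
        rwa [hqrc] at this
    have hle := h.le p hp
    have hno : ¬ p.1.1 < colLen P p.1.2 := by
      rw [hocc]
      rintro ⟨q, hq, hqp, h1⟩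
      exact hqp (h.inj q hq p hp h1)
    have hbelow : ∀ r c, r ≤ c → r ≤ p.1.1 → c ≤ p.1.2 → (r, c) ≠ p.1 → r < colLen P c := by
      intro r c h1 h2 h3 h4
      obtain ⟨q, hq, hq1⟩ := h.down p hp r c h1 h2 h3
      exact (hocc r c).2 ⟨q, hq, fun h5 => h4 (h5 ▸ hq1.symm), hq1⟩
    refine ⟨p :: P, ⟨hB, ?_, ?_⟩, ⟨hO, fun q hq => ?_⟩, fun q => ?_⟩
    · have h1 := hB.isShape p.1.1 p.1.2
      by_cases h2 : p.1.1 = p.1.2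
      · omega
      · have h3 := (hB.isShape p.1.1 (p.1.2 - 1)).1
          (hbelow _ _ (by omega) le_rfl (by omega) (by rw [ne_eq, Prod.ext_iff]; simp; omega))
        omega
    · by_contra h1
      have h2 := hbelow (p.1.1 - 1) p.1.2 (by omega) (by omega) le_rfl
        (by rw [ne_eq, Prod.ext_iff]; simp; omega)
      omega
    · have hq' := (hm q).1 (List.mem_of_mem_head? hq)
      exact hmax q hq'.2 hq'.1
    · rw [List.mem_cons, hm]
      constructor
      · rintro (rfl | h1)
        · exact hp
        · exact h1.2
      · intro h1
        by_cases h2 : q = p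
        · exact Or.inl h2
        · exact Or.inr ⟨h2, h1⟩

end IsFilling

section Tableau

variable {T : STab} {r c r' c' : ℕ} {u v x y : Letter}

theorem entry?_eq_some_iff : entry? T r c = some v ↔ r ≤ c ∧ (T.getD r [])[c - r]? = some v := by
  unfold entry? entryG?
  rw [List.getD_eq_getElem?_getD]
  split_ifs with h
  · cases T[r]? <;> simp [h]
  · simp [h]

theorem exists_entry?_iff :
    (∃ v, entry? T r c = some v) ↔ r ≤ c ∧ c < r + (T.getD r []).length := by
  simp only [entry?_eq_some_iff, exists_and_left]
  constructor
  · rintro ⟨h, v, hv⟩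
    obtain ⟨h1, _⟩ := List.getElem?_eq_some_iff.1 hv
    exact ⟨h, by omega⟩
  · rintro ⟨h, h1⟩
    exact ⟨h, _, List.getElem?_eq_getElem (by omega)⟩

theorem IsShifted.nil_notMem (h : IsShifted T) : [] ∉ T := fun h1 => by
  have := h.2 0 (List.mem_map.2 ⟨[], h1, rfl⟩)
  omega

theorem IsShifted.length_succ (h : IsShifted T) :
    (T.getD (r + 1) []).length ≤ (T.getD r []).length - 1 := by
  by_cases hr : r + 1 < T.length
  · have h1 := (List.isChain_iff_getElem.1 h.1) r (by simpa [shapeOf] using hr)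
    simp only [shapeOf, List.getElem_map] at h1
    rw [List.getD_eq_getElem _ _ hr, List.getD_eq_getElem _ _ (by omega)]
    omega
  · rw [List.getD_eq_default _ _ (by omega)]
    simp

theorem IsShifted.length_add (h : IsShifted T) (n : ℕ) (hn : 0 < (T.getD (r + n) []).length) :
    n + (T.getD (r + n) []).length ≤ (T.getD r []).length := by
  induction n with
  | zero => simp
  | succ n ih =>
    have h1 := h.length_succ (r := r + n)
    rw [← add_assoc] at hn ⊢
    have := ih (by omega)
    omega

theorem IsShifted.down (h : IsShifted T) (hv : ∃ v, entry? T r c = some v) (hrc : r' ≤ c')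
    (hr : r' ≤ r) (hc : c' ≤ c) : ∃ v, entry? T r' c' = some v := by
  rw [exists_entry?_iff] at hv ⊢
  obtain ⟨n, rfl⟩ := Nat.exists_eq_add_of_le hr
  have := h.length_add n (r := r') (by omega)
  omega

theorem IsShifted.row_le (h : IsShifted T) (hT : IsSemistandard T) (n : ℕ)
    (hx : entry? T r c = some x) (hy : entry? T r (c + n) = some y) : x ≤ y := by
  induction n generalizing y with
  | zero => rw [add_zero, hx] at hy; exact (Option.some.inj hy).le
  | succ n ih =>
    have h1 := (entry?_eq_some_iff.1 hx).1
    obtain ⟨z, hz⟩ := h.down (r' := r) (c' := c + n) ⟨y, hy⟩ (by omega) le_rfl (by omega)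
    exact (ih hz).trans (hT.2.1 r (c + n) z y hz hy)

theorem IsShifted.col_le (h : IsShifted T) (hT : IsSemistandard T) (n : ℕ)
    (hx : entry? T r c = some x) (hy : entry? T (r + n) c = some y) : x ≤ y := by
  induction n generalizing y with
  | zero => rw [add_zero, hx] at hy; exact (Option.some.inj hy).le
  | succ n ih =>
    have h1 := (entry?_eq_some_iff.1 hy).1
    obtain ⟨z, hz⟩ := h.down (r' := r + n) (c' := c) ⟨y, hy⟩ (by omega) (by omega) le_rfl
    exact (ih hz).trans (hT.2.2.1 (r + n) c z y hz hy)

theorem IsShifted.boxLt (h : IsShifted T) (hT : IsSemistandard T) (hx : entry? T r c = some x)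
    (hy : entry? T r' c' = some y) (hr : r ≤ r') (hc : c ≤ c') (hne : r ≠ r' ∨ c ≠ c') :
    BoxLt ((r, c), x) ((r', c'), y) := by
  have h1 := (entry?_eq_some_iff.1 hx).1
  obtain ⟨z, hz⟩ := h.down (r' := r) (c' := c') ⟨y, hy⟩ (by omega) hr le_rfl
  obtain ⟨m, rfl⟩ := Nat.exists_eq_add_of_le hr
  obtain ⟨n, rfl⟩ := Nat.exists_eq_add_of_le hc
  have hxz := h.row_le hT n hx hz
  have hzy := h.col_le hT m hz hy
  have hrow : 0 < n → x = z → x.primed = false := fun h2 h3 =>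
    hT.2.2.2.1 r c (c + n) x (by omega) hx (h3 ▸ hz)
  have hcol : 0 < m → z = y → z.primed = true := fun h2 h3 =>
    hT.2.2.2.2 r (r + m) (c + n) z (by omega) hz (h3 ▸ hy)
  have hm : m = 0 → z = y := by
    rintro rfl
    rw [add_zero, hz] at hy
    exact Option.some.inj hy
  rw [Letter.le_iff] at hxz hzy
  rw [Letter.ext_iff'] at hrow hcol hm
  unfold BoxLt BoxPrec
  simp only
  rcases Nat.eq_zero_or_pos m with rfl | hm0
  · have hn : 0 < n := by omega
    cases hxp : x.primed <;> cases hyp : y.primed <;> simp_all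
  · cases hxp : x.primed <;> cases hyp : y.primed <;> cases hzp : z.primed <;> simp_all <;> omega

theorem finite_cells (T : STab) : {p : (ℕ × ℕ) × Letter | entry? T p.1.1 p.1.2 = some p.2}.Finite := by
  refine Set.Finite.subset (((Finset.range T.length ×ˢ
    Finset.range (T.length + T.flatten.length)) ×ˢ T.flatten.toFinset).finite_toSet) ?_
  rintro ⟨⟨r, c⟩, v⟩ h
  simp only [Set.mem_ofPred_eq, entry?_eq_some_iff] at h
  obtain ⟨h1, h2⟩ := List.getElem?_eq_some_iff.1 h.2
  have hr : r < T.length := by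
    by_contra h3
    rw [List.getD_eq_default _ _ (by omega)] at h1
    simp at h1
  have hmem : T.getD r [] ∈ T := by
    rw [List.getD_eq_getElem _ _ hr]
    exact List.getElem_mem hr
  have hlen := (List.sublist_flatten_of_mem hmem).length_le
  simp only [Finset.coe_product, Set.mem_prod, Finset.coe_range, Set.mem_Iio,
    List.coe_toFinset, Set.mem_ofPred_eq, List.mem_flatten]
  exact ⟨⟨hr, by omega⟩, _, hmem, h2 ▸ List.getElem_mem h1⟩

theorem IsShifted.exists_chain (h : IsShifted T) (hT : IsSemistandard T) :
    ∃ P : BoxChain, P.Built ∧ P.Ordered ∧ P.toTab = T := by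
  have hmem : ∀ p, p ∈ (finite_cells T).toFinset ↔ entry? T p.1.1 p.1.2 = some p.2 := by simp
  have hS : IsFilling (finite_cells T).toFinset := by
    constructor
    · intro p hp
      exact (entry?_eq_some_iff.1 ((hmem p).1 hp)).1
    · intro p hp q hq hpq
      rw [hmem] at hp hq
      rw [hpq, hq] at hp
      exact Prod.ext hpq (Option.some.inj hp).symm
    · intro p hp r c hrc hr hc
      obtain ⟨v, hv⟩ := h.down ⟨_, (hmem p).1 hp⟩ hrc hr hc
      exact ⟨((r, c), v), (hmem _).2 hv, rfl⟩
    · intro p hp q hq hr hc hpq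
      rw [hmem] at hp hq
      refine h.boxLt hT hp hq hr hc ?_
      by_contra! h1
      have h2 : p.1 = q.1 := Prod.ext h1.1 h1.2
      rw [h2, hq] at hp
      exact hpq (Prod.ext h2 (Option.some.inj hp).symm)
  obtain ⟨P, hB, hO, hP⟩ := hS.exists_chain
  refine ⟨P, hB, hO, (BoxChain.represents_toTab hB).unique ⟨fun r => ?_, h.nil_notMem⟩⟩
  refine List.ext_getElem? fun k => Option.ext fun v => ?_
  rw [hB.getElem?_rows, hP, hmem, entry?_eq_some_iff]
  simp

end Tableau

/-- The relation between consecutive columns of a primed compatible sequence. -/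
def ColumnLt (p q : ℕ × Letter) : Prop := p.1 < q.1 ∨ (p.1 = q.1 ∧ p.2.Tri q.2)

instance : IsTrans (ℕ × Letter) ColumnLt where
  trans p q r h1 h2 := by
    unfold ColumnLt Letter.Tri at *
    cases hr : r.2.primed <;> simp_all <;> omega

theorem isPrimedCompatible_iff {φ : List (ℕ × Letter)} :
    IsPrimedCompatible φ ↔
      (∀ p ∈ φ, 0 < p.1 ∧ 0 < p.2.ceil) ∧ φ.IsChain ColumnLt := by
  unfold IsPrimedCompatible
  refine and_congr_right fun _ => ⟨fun ⟨h1, h2⟩ => ?_, fun h => ⟨?_, ?_⟩⟩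
  · rw [List.isChain_iff_getElem]
    intro i hi
    obtain ⟨h3, h4⟩ := (List.isChain_iff_getElem.1 h1) i hi
    have h5 := h2 i (i + 1) φ[i + 1] (by omega)
    rw [List.getElem?_eq_getElem hi, List.getElem?_eq_getElem (by omega), Option.some_inj,
      Prod.ext_iff, Letter.ext_iff'] at h5
    rw [Letter.le_iff] at h4
    unfold ColumnLt Letter.Tri
    cases hp : φ[i].2.primed <;> cases hq : φ[i + 1].2.primed <;> simp_all <;> omega
  · refine List.IsChain.imp (fun p q hpq => ?_) h
    rw [Letter.le_iff]
    unfold ColumnLt Letter.Tri at hpq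
    cases hp : p.2.primed <;> cases hq : q.2.primed <;> simp_all <;> omega
  · intro k l p hkl hk hl
    obtain ⟨hk', rfl⟩ := List.getElem?_eq_some_iff.1 hk
    obtain ⟨hl', hlk⟩ := List.getElem?_eq_some_iff.1 hl
    have h1 := (List.pairwise_iff_getElem.1 h.pairwise) k l hk' hl' hkl
    rw [hlk] at h1
    unfold ColumnLt Letter.Tri at h1
    simpa using h1

theorem PSWO_concat (φ : List (ℕ × Letter)) (p : ℕ × Letter) :
    PSWO (φ ++ [p]) = (swInsertO (PSWO φ) p.2).1 := by
  simp [PSWO]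

theorem QSWaux_concat (ins : STab → Letter → STab × Bool) (P Q : STab) (φ : List (ℕ × Letter))
    (p : ℕ × Letter) :
    QSWaux ins P Q (φ ++ [p]) =
      addBox (QSWaux ins P Q φ) (φ.foldl (fun T p => (ins T p.2).1) P)
        (ins (φ.foldl (fun T p => (ins T p.2).1) P) p.2).1
        ⟨(p.1 : ℤ), (ins (φ.foldl (fun T p => (ins T p.2).1) P) p.2).2⟩ := by
  induction φ generalizing P Q with
  | nil => rfl
  | cons q φ ih => exact ih _ _

theorem QSWO_concat (φ : List (ℕ × Letter)) (p : ℕ × Letter) :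
    QSWO (φ ++ [p]) = addBox (QSWO φ) (PSWO φ) (swInsertO (PSWO φ) p.2).1
      ⟨(p.1 : ℤ), (swInsertO (PSWO φ) p.2).2⟩ :=
  QSWaux_concat _ _ _ _ _

/-- The chains of the insertion and recording tableaux of a sequence of columns, the last column
coming first. -/
inductive Records : List (ℕ × Letter) → BoxChain → BoxChain → Prop
  | nil : Records [] [] []
  | cons {ψ : List (ℕ × Letter)} {P P' Q : BoxChain} {p : ℕ × Letter} {b : ℕ × ℕ} {f : Bool}
      (h : Records ψ P Q) (hi : P.Ins p.2 P' b f) :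
      Records (p :: ψ) P' ((b, ⟨(p.1 : ℤ), f⟩) :: Q)

namespace Records

open BoxChain

variable {ψ ψ' : List (ℕ × Letter)} {P Q : BoxChain}

theorem exists_chains : ∀ ψ : List (ℕ × Letter), ∃ P Q, Records ψ P Q
  | [] => ⟨_, _, nil⟩
  | p :: ψ => by
    obtain ⟨P, Q, h⟩ := exists_chains ψ
    obtain ⟨P', b, f, hi⟩ := exists_ins P p.2
    exact ⟨_, _, h.cons hi⟩

theorem valid (h : Records ψ P Q) : P.Valid := by
  induction h with
  | nil => exact valid_nil
  | cons _ hi ih => exact hi.valid ih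

theorem shape (h : Records ψ P Q) :
    Q.Built ∧ rowLen Q = rowLen P ∧ colLen Q = colLen P := by
  induction h with
  | nil => exact ⟨trivial, rfl, rfl⟩
  | cons h hi ih =>
    obtain ⟨h1, h2, h3⟩ := ih
    obtain ⟨h4, h5, -⟩ := hi.built h.valid.1
    refine ⟨⟨h1, ?_⟩, ?_, ?_⟩
    · unfold Addable at h4 ⊢
      rwa [h2, h3]
    · rw [rowLen_cons, h5.1, h2]
    · rw [colLen_cons, h5.2, h3]

theorem ordered_iff (h : Records ψ P Q) :
    Q.Ordered ↔ ψ.IsChain (fun q p => ColumnLt p q) := by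
  induction h with
  | nil => simp [Ordered]
  | @cons ψ P P' Q p b f h hi ih =>
    rw [Ordered, ih]
    cases h with
    | nil => simp [HeadLt]
    | @cons ψ P₀ _ Q q b₀ f₀ h hi₀ =>
      rw [List.isChain_cons_cons, and_comm]
      refine and_congr_left fun _ => ?_
      unfold ColumnLt
      rw [hi₀.tri_iff hi h.valid.1]
      simp [HeadLt, BoxLt]

theorem tableaux (h : Records ψ P Q) : PSWO ψ.reverse = P.toTab ∧ QSWO ψ.reverse = Q.toTab := by
  induction h with
  | nil => exact ⟨rfl, rfl⟩
  | cons h hi ih =>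
    have hv := h.valid
    rw [List.reverse_cons, PSWO_concat, QSWO_concat, ih.1, ih.2, hi.swInsertO hv]
    exact ⟨rfl, addBox_toTab hv.1 (hi.valid hv).1 (hi.built hv.1).2.1.1⟩

theorem inj (h : Records ψ P Q) (h' : Records ψ' P Q) : ψ = ψ' := by
  induction h generalizing ψ' with
  | nil => cases h'; rfl
  | @cons ψ P P' Q p b f h hi ih =>
    generalize hQ : (b, (⟨(p.1 : ℤ), f⟩ : Letter)) :: Q = Q' at h'
    cases h' with
    | nil => simp at hQ
    | @cons ψ' P₁ _ Q₁ q b₁ f₁ h₁ hi₁ =>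
      simp only [List.cons.injEq, Prod.mk.injEq, Letter.mk.injEq, Nat.cast_inj] at hQ
      obtain ⟨⟨rfl, hpq, rfl⟩, rfl⟩ := hQ
      obtain ⟨rfl, hu⟩ := hi.inj hi₁ h.valid h₁.valid
      rw [ih h₁, Prod.ext hpq hu]

theorem exists_of_shape (hQ : Q.Built) (hP : P.Valid) (hr : rowLen Q = rowLen P)
    (hpos : ∀ p ∈ Q, 0 < p.2.ceil) : ∃ ψ, Records ψ P Q := by
  induction Q generalizing P with
  | nil =>
    cases P with
    | nil => exact ⟨_, nil⟩
    | cons p P =>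
      have := congrFun hr p.1.1
      rw [rowLen_cons] at this
      simp [plusRow] at this
  | cons q Q ih =>
    obtain ⟨b, l⟩ := q
    have hc := hQ.colLen_eq hP.1 hr
    have hrem : P.Removable b := by
      unfold Removable
      rw [← hr, ← hc, rowLen_cons, colLen_cons]
      exact IsShape.removable_plus hQ.2
    obtain ⟨P₀, u, hP₀, hi⟩ := exists_ins_eq P hP b hrem l.primed
    have hr₀ : rowLen Q = rowLen P₀ := by
      have h1 := (hi.built hP₀.1).2.1.1
      rw [← hr, rowLen_cons] at h1
      funext r
      have := congrFun h1 r
      simp only [plusRow] at this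
      omega
    obtain ⟨ψ, hψ⟩ := ih hQ.1 hP₀ hr₀ fun p hp => hpos p (by simp [hp])
    have h2 := hψ.cons (p := (l.ceil.toNat, u)) hi
    have hl : (⟨((l.ceil.toNat : ℕ) : ℤ), l.primed⟩ : Letter) = l := by
      have := hpos (b, l) (by simp)
      exact Letter.ext_iff'.2 ⟨Int.toNat_of_nonneg this.le, rfl⟩
    rw [hl] at h2
    exact ⟨_, h2⟩

theorem ceil_perm (h : Records ψ P Q) :
    (P.map (fun p => p.2.ceil)).Perm (ψ.map (fun p => p.2.ceil)) := by
  induction h with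
  | nil => rfl
  | cons h hi ih => exact hi.ceil_perm.trans (ih.cons _)

theorem recorded_ceil (h : Records ψ P Q) :
    Q.map (fun p => p.2.ceil) = ψ.map (fun p => (p.1 : ℤ)) := by
  induction h with
  | nil => rfl
  | cons h hi ih => simp [ih]

theorem pos_letters (h : Records ψ P Q) (hψ : ∀ p ∈ ψ, 0 < p.1 ∧ 0 < p.2.ceil) :
    (∀ p ∈ P, 0 < p.2.ceil) ∧ ∀ q ∈ Q, 0 < q.2.ceil := by
  constructor
  · intro p hp
    have h1 := h.ceil_perm.subset (List.mem_map_of_mem (f := fun p => p.2.ceil) hp)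
    obtain ⟨q, hq, hqp⟩ := List.mem_map.1 h1
    rw [← hqp]
    exact (hψ q hq).2
  · intro p hp
    have h1 := List.mem_map_of_mem (f := fun p => p.2.ceil) hp
    rw [h.recorded_ceil] at h1
    obtain ⟨q, hq, hqp⟩ := List.mem_map.1 h1
    have := (hψ q hq).1
    omega

end Records

theorem BoxChain.countP_toTab (P : BoxChain) (j : ℤ) :
    (toTab P).flatten.countP (fun x => decide (x.ceil = j)) =
      (P.map (fun p => p.2.ceil)).count j := by
  rw [(flatten_toTab P).countP_eq, List.countP_map, List.count_eq_countP, List.countP_map]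
  rfl

theorem sum_countP_fiber {α : Type*} (g : α → ℕ) (q : α → Prop) [DecidablePred q] (l : List α)
    (s : Finset ℕ) (hs : ∀ a ∈ l, g a ∈ s) :
    ∑ i ∈ s, l.countP (fun a => decide (g a = i ∧ q a)) = l.countP (fun a => decide (q a)) := by
  induction l with
  | nil => simp
  | cons a l ih =>
    simp only [List.countP_cons, Finset.sum_add_distrib]
    rw [ih fun b hb => hs b (by simp [hb])]
    congr 1
    by_cases hq : q a <;> simp [hq, hs a]

theorem finsum_countP_fiber {α : Type*} (g : α → ℕ) (q : α → Prop) [DecidablePred q]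
    (l : List α) :
    ∑ᶠ i, l.countP (fun a => decide (g a = i ∧ q a)) = l.countP (fun a => decide (q a)) := by
  rw [finsum_eq_finsetSum_of_support_subset (s := (l.map g).toFinset)]
  · exact sum_countP_fiber g q l _ fun a ha => List.mem_toFinset.2 (List.mem_map_of_mem ha)
  · intro i hi
    obtain ⟨a, ha, h⟩ := List.countP_pos_iff.1 (Nat.pos_of_ne_zero hi)
    simp only [decide_eq_true_eq] at h
    simp only [List.coe_toFinset, List.mem_map]
    exact ⟨a, ha, h.1⟩

theorem finsum_cmEntry_left (φ : List (ℕ × Letter)) (j : ℕ) :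
    ∑ᶠ i : ℕ, cmEntry φ i j = (φ.map (fun p => p.2.ceil)).count (j : ℤ) := by
  unfold cmEntry
  rw [finsum_countP_fiber (fun p : ℕ × Letter => p.1) (fun p => p.2.ceil = (j : ℤ)),
    List.count_eq_countP, List.countP_map]
  congr

theorem finsum_cmEntry_right {φ : List (ℕ × Letter)} (hφ : ∀ p ∈ φ, 0 < p.2.ceil) (j : ℕ) :
    ∑ᶠ k : ℕ, cmEntry φ j k = (φ.map (fun p => (p.1 : ℤ))).count (j : ℤ) := by
  have h : ∀ k, cmEntry φ j k =
      φ.countP (fun p => decide (p.2.ceil.toNat = k ∧ p.1 = j)) := by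
    intro k
    refine List.countP_congr fun p hp => ?_
    have := hφ p hp
    simp only [decide_eq_true_eq]
    omega
  simp only [h]
  rw [finsum_countP_fiber (fun p : ℕ × Letter => p.2.ceil.toNat) (fun p => p.1 = j),
    List.count_eq_countP, List.countP_map]
  refine List.countP_congr fun p _ => ?_
  simp

/-- Theorem 5.4: `φ ↦ (P_SWᴼ(φ), Q_SWᴼ(φ))` is a bijection from
primed compatible sequences to pairs of semistandard shifted tableaux of the same shape
with no primes on the main diagonal of `P`; moreover the row sums (resp. column sums) of
the circled matrix of `φ` give the entry counts of `P_SWᴼ(φ)` (resp. `Q_SWᴼ(φ)`). -/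
theorem stmt17 :
    Set.BijOn (fun φ => (PSWO φ, QSWO φ)) {φ : List (ℕ × Letter) | IsPrimedCompatible φ}
      {PQ : STab × STab | shapeOf PQ.1 = shapeOf PQ.2 ∧ IsShifted PQ.1 ∧ IsShifted PQ.2 ∧
        IsSemistandard PQ.1 ∧ IsSemistandard PQ.2 ∧ NoDiagPrimes PQ.1} ∧
    ∀ φ : List (ℕ × Letter), IsPrimedCompatible φ → ∀ j : ℕ,
      (∑ᶠ i : ℕ, cmEntry φ i j) =
        (PSWO φ).flatten.countP (fun x => decide (x.ceil = (j : ℤ))) ∧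
      (∑ᶠ k : ℕ, cmEntry φ j k) =
        (QSWO φ).flatten.countP (fun x => decide (x.ceil = (j : ℤ))) := by
  have hrec : ∀ φ, IsPrimedCompatible φ → ∃ P Q, Records φ.reverse P Q ∧ P.Valid ∧ Q.Built ∧
      Q.Ordered ∧ rowLen Q = rowLen P ∧ PSWO φ = P.toTab ∧ QSWO φ = Q.toTab := by
    intro φ hφ
    obtain ⟨P, Q, h⟩ := Records.exists_chains φ.reverse
    have h1 := h.tableaux
    rw [List.reverse_reverse] at h1
    refine ⟨P, Q, h, h.valid, h.shape.1, ?_, h.shape.2.1, h1⟩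
    rw [h.ordered_iff, List.isChain_reverse]
    exact (isPrimedCompatible_iff.1 hφ).2
  refine ⟨⟨fun φ hφ => ?_, fun φ hφ φ' hφ' heq => ?_, fun ⟨S, T⟩ h => ?_⟩, fun φ hφ j => ?_⟩
  · obtain ⟨P, Q, h, hP, hQ, hQ', hr, h1, h2⟩ := hrec φ hφ
    have hpos := h.pos_letters fun p hp => hφ.1 p (List.mem_reverse.1 hp)
    simp only [Set.mem_ofPred_eq, h1, h2]
    exact ⟨(BoxChain.shapeOf_toTab_eq_iff hP.1 hQ).2 hr.symm, BoxChain.isShifted_toTab hP.1,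
      BoxChain.isShifted_toTab hQ, BoxChain.isSemistandard_toTab hP.1 hP.2.2 hpos.1,
      BoxChain.isSemistandard_toTab hQ hQ' hpos.2, (BoxChain.noDiagPrimes_toTab hP.1).2 hP.2.1⟩
  · obtain ⟨P, Q, h, hP, hQ, hQ', hr, h1, h2⟩ := hrec φ hφ
    obtain ⟨P₁, Q₁, h', hP₁, hQ₁, hQ₁', hr₁, h1', h2'⟩ := hrec φ' hφ'
    simp only [Prod.mk.injEq, h1, h2, h1', h2'] at heq
    obtain rfl := BoxChain.toTab_inj hP.1 hP₁.1 hP.2.2 hP₁.2.2 heq.1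
    obtain rfl := BoxChain.toTab_inj hQ hQ₁ hQ' hQ₁' heq.2
    exact List.reverse_injective (h.inj h')
  · obtain ⟨hsh, hS, hT, hS', hT', hd⟩ := h
    obtain ⟨P, hP, hP', rfl⟩ := hS.exists_chain hS'
    obtain ⟨Q, hQ, hQ', rfl⟩ := hT.exists_chain hT'
    have hpos : ∀ {R : BoxChain}, IsSemistandard R.toTab → ∀ p ∈ R, 0 < p.2.ceil := by
      intro R hR p hp
      exact hR.1 _ ((BoxChain.flatten_toTab R).mem_iff.2 (List.mem_map_of_mem hp))
    obtain ⟨ψ, h⟩ := Records.exists_of_shape hQ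
      ⟨hP, (BoxChain.noDiagPrimes_toTab hP).1 hd, hP'⟩
      ((BoxChain.shapeOf_toTab_eq_iff hP hQ).1 hsh).symm (hpos hT')
    refine ⟨ψ.reverse, ?_, Prod.ext h.tableaux.1 h.tableaux.2⟩
    refine isPrimedCompatible_iff.2 ⟨fun p hp => ?_, ?_⟩
    · rw [List.mem_reverse] at hp
      constructor
      · have h1 := List.mem_map_of_mem (f := fun p => (p.1 : ℤ)) hp
        rw [← h.recorded_ceil] at h1
        obtain ⟨q, hq, hqp⟩ := List.mem_map.1 h1
        have := hpos hT' q hq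
        omega
      · have h1 := h.ceil_perm.symm.subset (List.mem_map_of_mem (f := fun p => p.2.ceil) hp)
        obtain ⟨q, hq, hqp⟩ := List.mem_map.1 h1
        rw [← hqp]
        exact hpos hS' q hq
    · rw [List.isChain_reverse]
      exact h.ordered_iff.1 hQ'
  · obtain ⟨P, Q, h, -, -, -, -, h1, h2⟩ := hrec φ hφ
    rw [finsum_cmEntry_left, finsum_cmEntry_right fun p hp => (hφ.1 p hp).2, h1, h2,
      BoxChain.countP_toTab, BoxChain.countP_toTab, h.ceil_perm.count_eq, h.recorded_ceil,
      List.map_reverse, List.map_reverse, List.count_reverse, List.count_reverse]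
    exact ⟨rfl, rfl⟩
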